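/- arXiv:2011.10641 — 11 statements merged into one kernel-verified Lean document; each statement's English description precedes it below -/
import Mathlib

section
/- Let G be a finite simple graph on n vertices and let v be a vertex of G of degree d. Then for every real number p, NRel(G,p) = (1-p)·NRel(G-v,p) + p·( NRel(G/v,p) − (1-p)^d·NRel(G-N[v],p) + (1-p)^{n-1} ), where the node reliability of a graph with empty vertex set is 0. (This is the pivoting theorem for node reliability; note the last two terms carry the signs that make the identity an exact polynomial identity in p.) -/
open SimpleGraph

/-- `S_k(G)`: the number of connected sets of `G` of cardinality `k`, i.e. the number of
vertex subsets of size `k` inducing a connected subgraph. -/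
noncomputable def connCount {V : Type} (G : SimpleGraph V) (k : ℕ) : ℕ :=
  Nat.card {S : Finset V // S.card = k ∧ (G.induce (S : Set V)).Connected}

/-- The node reliability `NRel(G,p) = Σ_{k=1}^n S_k(G) p^k (1-p)^{n-k}` where `n` is the
order of `G`.  (For a graph with empty vertex set this is `0`.) -/
noncomputable def NRel {V : Type} (G : SimpleGraph V) (p : ℝ) : ℝ :=
  ∑ k ∈ Finset.Icc 1 (Nat.card V),
    (connCount G k : ℝ) * p ^ k * (1 - p) ^ (Nat.card V - k)

/-- `G − v`: the induced subgraph on `V(G) ∖ {v}`. -/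
def delVert {V : Type} (G : SimpleGraph V) (v : V) : SimpleGraph ↥{u : V | u ≠ v} :=
  G.induce {u : V | u ≠ v}

/-- `G − N[v]`: the induced subgraph on `V(G) ∖ N[v]`. -/
def delClosedNbhd {V : Type} (G : SimpleGraph V) (v : V) :
    SimpleGraph ↥{u : V | ¬ G.Adj v u ∧ u ≠ v} :=
  G.induce {u : V | ¬ G.Adj v u ∧ u ≠ v}

/-- `G / v`: the graph on `V(G) ∖ {v}` where `u,w` are adjacent iff `uw ∈ E(G)` or both
`u` and `w` are neighbours of `v` in `G`. -/
def pivotContract {V : Type} (G : SimpleGraph V) (v : V) : SimpleGraph ↥{u : V | u ≠ v} :=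
  SimpleGraph.fromRel (fun a b => G.Adj a.1 b.1 ∨ (G.Adj v a.1 ∧ G.Adj v b.1))

open Classical in
lemma NRel_eq_sum {V : Type} [Fintype V] (G : SimpleGraph V) (p : ℝ) :
    NRel G p = ∑ S : Finset V, if (G.induce (S : Set V)).Connected then
      p ^ S.card * (1 - p) ^ (Fintype.card V - S.card) else 0 := by
  unfold NRel
  rw [← Finset.sum_filter, Nat.card_eq_fintype_card]
  rw [← Finset.sum_fiberwise_of_maps_to (s := Finset.univ.filter
    (fun S : Finset V => (G.induce (S : Set V)).Connected))
    (t := Finset.Icc 1 (Fintype.card V)) (g := fun S => S.card)]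
  · refine Finset.sum_congr rfl fun k hk => ?_
    rw [Finset.sum_congr rfl (g := fun _ => p ^ k * (1 - p) ^ (Fintype.card V - k))]
    · rw [Finset.sum_const, nsmul_eq_mul, mul_assoc]
      congr 2
      unfold connCount
      rw [Nat.card_eq_fintype_card, Fintype.card_subtype]
      congr 1
      ext S
      simp [and_comm]
    · intro S hS
      rw [(Finset.mem_filter.1 hS).2]
  · intro S hS
    rw [Finset.mem_filter] at hS
    rw [Finset.mem_Icc]
    refine ⟨?_, Finset.card_le_univ S⟩
    obtain ⟨x⟩ := hS.2.nonempty
    exact Finset.card_pos.2 ⟨x.1, x.2⟩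

lemma conn_map {V : Type} (H : SimpleGraph V) (s : Set V) (S : Finset s) :
    ((H.induce s).induce (S : Set s)).Connected ↔
    (H.induce ((S.map (Function.Embedding.subtype _) : Finset V) : Set V)).Connected := by
  refine SimpleGraph.Iso.connected_iff
    { toFun := fun x => ⟨x.1.1, by simp⟩
      invFun := fun x => ⟨⟨x.1, ?_⟩, ?_⟩
      left_inv := fun x => rfl
      right_inv := fun x => rfl
      map_rel_iff' := ?_ }
  · have := x.2
    simp at this
    exact this.1
  · have := x.2
    simp at this
    exact this.2
  · intro a b
    simp

open Classical in
lemma NRel_induce {V : Type} [Fintype V] (H : SimpleGraph V) (s : Set V) (A : Finset V)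
    (hA : ∀ x, x ∈ A ↔ x ∈ s) (p : ℝ) :
    NRel (H.induce s) p = ∑ S ∈ A.powerset, if (H.induce (S : Set V)).Connected then
      p ^ S.card * (1 - p) ^ (A.card - S.card) else 0 := by
  rw [NRel_eq_sum]
  have hc : Fintype.card s = A.card := Fintype.card_of_finset' A hA
  refine Finset.sum_bij (fun S _ => S.map (Function.Embedding.subtype _)) ?_ ?_ ?_ ?_
  · intro S _
    rw [Finset.mem_powerset]
    intro x hx
    rw [hA]
    simp at hx
    exact hx.1
  · intro S _ T _ h
    exact Finset.map_injective _ h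
  · intro T hT
    rw [Finset.mem_powerset] at hT
    refine ⟨T.subtype (· ∈ s), Finset.mem_univ _, ?_⟩
    rw [Finset.subtype_map]
    exact Finset.filter_true_of_mem fun x hx => (hA x).1 (hT hx)
  · intro S _
    rw [Finset.card_map, hc]
    have hm := conn_map H s S
    by_cases h : ((H.induce s).induce (S : Set s)).Connected
    · rw [if_pos h, if_pos (hm.1 h)]
    · rw [if_neg h, if_neg (fun h' => h (hm.2 h'))]

lemma reach_map {V W : Type} {G : SimpleGraph V} {H : SimpleGraph W} (f : V → W)
    (hf : ∀ a b, G.Adj a b → H.Reachable (f a) (f b)) {a b : V} (h : G.Reachable a b) :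
    H.Reachable (f a) (f b) := by
  obtain ⟨w⟩ := h
  induction w with
  | nil => exact Reachable.refl _
  | cons h _ ih => exact (hf _ _ h).trans ih

def ctr {V : Type} (G : SimpleGraph V) (v : V) : SimpleGraph V :=
  SimpleGraph.fromRel (fun a b => G.Adj a b ∨ (G.Adj v a ∧ G.Adj v b))

lemma pivot_eq {V : Type} (G : SimpleGraph V) (v : V) :
    pivotContract G v = (ctr G v).induce {u : V | u ≠ v} := by
  ext a b
  simp [pivotContract, ctr, Subtype.ext_iff]

lemma ctr_adj {V : Type} (G : SimpleGraph V) (v a b : V) :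
    (ctr G v).Adj a b ↔ a ≠ b ∧ (G.Adj a b ∨ (G.Adj v a ∧ G.Adj v b)) := by
  simp only [ctr, SimpleGraph.fromRel_adj, G.adj_comm b a]
  tauto

lemma key1 {V : Type} [DecidableEq V] (G : SimpleGraph V) (v : V) (T : Finset V) (hv : v ∉ T)
    (hT : T.Nonempty) :
    (G.induce ((insert v T : Finset V) : Set V)).Connected ↔
      ((ctr G v).induce (T : Set V)).Connected ∧ ∃ u ∈ T, G.Adj v u := by
  have hvm : v ∈ ((insert v T : Finset V) : Set V) := by simp
  have hin : ∀ x : (T : Set V), x.1 ∈ ((insert v T : Finset V) : Set V) := fun x => by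
    simpa using Or.inr x.2
  constructor
  · intro h
    have hu : ∃ u ∈ T, G.Adj v u := by
      obtain ⟨t, ht⟩ := hT
      obtain ⟨w⟩ := h.preconnected ⟨v, hvm⟩ ⟨t, hin ⟨t, ht⟩⟩
      cases w with
      | nil => exact absurd ht hv
      | @cons _ u _ e _ =>
        have e' : G.Adj v u.1 := e
        have := u.2
        simp at this
        rcases this with h1 | h1
        · exact absurd h1 e'.ne'
        · exact ⟨u.1, h1, e'⟩
    refine ⟨?_, hu⟩
    obtain ⟨u, huT, hu⟩ := hu
    let f : ((insert v T : Finset V) : Set V) → (T : Set V) := fun x =>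
      if hx : x.1 ∈ T then ⟨x.1, hx⟩ else ⟨u, huT⟩
    have hf : ∀ x : (T : Set V), f ⟨x.1, hin x⟩ = x := fun x => by
      have : x.1 ∈ T := x.2
      simp [f, this]
    have hvv : ∀ x : ((insert v T : Finset V) : Set V), x.1 ∉ T → x.1 = v := fun x hx => by
      have := x.2
      simp at this
      tauto
    have hR : ∀ a b : (T : Set V), (a.1 ≠ b.1 → (ctr G v).Adj a.1 b.1) →
        ((ctr G v).induce (T : Set V)).Reachable a b := by
      intro a b hab
      by_cases e : a.1 = b.1
      · rw [Subtype.ext e]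
      · exact Adj.reachable (hab e)
    have : Nonempty (T : Set V) := ⟨⟨u, huT⟩⟩
    refine ⟨fun a b => ?_⟩
    rw [← hf a, ← hf b]
    refine reach_map f ?_ (h.preconnected _ _)
    intro a b hab
    have hab' : G.Adj a.1 b.1 := hab
    apply hR
    intro hne
    rw [ctr_adj]
    refine ⟨hne, ?_⟩
    by_cases ha : a.1 ∈ T <;> by_cases hb : b.1 ∈ T
    · simp only [f, ha, hb, dif_pos]
      exact Or.inl hab'
    · have := hvv b hb
      simp only [f, ha, hb, dif_pos, dif_neg, not_false_eq_true]
      rw [this] at hab'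
      exact Or.inr ⟨hab'.symm, hu⟩
    · have := hvv a ha
      simp only [f, ha, hb, dif_pos, dif_neg, not_false_eq_true]
      rw [this] at hab'
      exact Or.inr ⟨hu, hab'⟩
    · exact absurd ((hvv a ha).trans (hvv b hb).symm) hab'.ne
  · rintro ⟨h, u, huT, hu⟩
    let g : ↥(T : Set V) → ((insert v T : Finset V) : Set V) := fun x => ⟨x.1, hin x⟩
    have hg : ∀ a b, (G.induce ((insert v T : Finset V) : Set V)).Reachable (g a) (g b) := by
      intro a b
      refine reach_map g ?_ (h.preconnected a b)
      intro a b hab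
      have hab' : (ctr G v).Adj a.1 b.1 := hab
      rw [ctr_adj] at hab'
      rcases hab'.2 with h1 | ⟨h1, h2⟩
      · exact Adj.reachable h1
      · exact (Adj.reachable (G := G.induce ((insert v T : Finset V) : Set V))
          (u := g a) (v := ⟨v, hvm⟩) h1.symm).trans (Adj.reachable h2)
    have hg2 : ∀ x, (G.induce ((insert v T : Finset V) : Set V)).Reachable x (g ⟨u, huT⟩) := by
      intro x
      by_cases hx : x.1 ∈ T
      · exact hg ⟨x.1, hx⟩ _
      · have h1 : x = ⟨v, hvm⟩ := by
          have := x.2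
          simp at this
          apply Subtype.ext
          tauto
        rw [h1]
        exact Adj.reachable hu
    have : Nonempty ((insert v T : Finset V) : Set V) := ⟨⟨v, hvm⟩⟩
    exact ⟨fun a b => (hg2 a).trans (hg2 b).symm⟩

lemma key2 {V : Type} (G : SimpleGraph V) (v : V) (T : Finset V)
    (hT : ∀ u ∈ T, ¬ G.Adj v u) :
    (ctr G v).induce (T : Set V) = G.induce (T : Set V) := by
  ext a b
  have := hT a.1 a.2
  simp only [SimpleGraph.comap_adj, Function.Embedding.subtype_apply, ctr_adj]
  constructor
  · tauto
  · intro h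
    exact ⟨h.ne, Or.inl h⟩

theorem nrel_pivot (n : ℕ) (G : SimpleGraph (Fin n)) (v : Fin n) (d : ℕ)
    (hd : (G.neighborSet v).ncard = d) (p : ℝ) :
    NRel G p =
      (1 - p) * NRel (delVert G v) p +
        p * (NRel (pivotContract G v) p
              - (1 - p) ^ d * NRel (delClosedNbhd G v) p + (1 - p) ^ (n - 1)) := by
  classical
  set A : Finset (Fin n) := Finset.univ.erase v with hA
  have hvA : v ∉ A := by simp [hA]
  have hAc : A.card = n - 1 := by simp [hA]
  have hn : 0 < n := v.pos
  set B : Finset (Fin n) := A.filter (fun u => ¬ G.Adj v u) with hB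
  have hBc : d + B.card = n - 1 := by
    rw [← hAc, ← Finset.card_filter_add_card_filter_not (s := A) (fun u => G.Adj v u), ← hd,
      ← Set.ncard_coe_finset (A.filter (fun u => G.Adj v u))]
    congr 2
    ext u
    simp only [mem_neighborSet, hA, Finset.coe_filter, Finset.mem_erase, Finset.mem_univ,
      Set.mem_setOf_eq, and_true]
    exact ⟨fun h => ⟨h.ne', h⟩, fun h => h.2⟩
  rw [pivot_eq, delVert, delClosedNbhd, NRel_induce _ _ A (by simp [hA]),
    NRel_induce _ _ A (by simp [hA]), NRel_induce _ _ B (by simp [hB, hA, and_comm]), NRel_eq_sum]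
  have hu : (Finset.univ : Finset (Finset (Fin n))) = (insert v A).powerset := by
    rw [hA, Finset.insert_erase (Finset.mem_univ v), Finset.powerset_univ]
  rw [hu, Finset.sum_powerset_insert hvA, Fintype.card_fin]
  have e0 : (1 - p) ^ (n - 1) = ∑ T ∈ A.powerset, if T = ∅ then (1 - p) ^ (n - 1) else 0 := by
    simp
  have hBA : B.powerset = A.powerset.filter (fun T => ∀ u ∈ T, ¬ G.Adj v u) := by
    ext T
    simp only [Finset.mem_powerset, Finset.mem_filter, hB, Finset.subset_iff]
    exact ⟨fun h => ⟨fun x hx => (h hx).1, fun x hx => (h hx).2⟩,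
      fun h x hx => ⟨h.1 hx, h.2 x hx⟩⟩
  rw [e0, hBA, Finset.sum_filter]
  simp only [Finset.mul_sum]
  congr 1
  · refine Finset.sum_congr rfl fun T hT => ?_
    have := Finset.card_le_card (Finset.mem_powerset.1 hT)
    rw [mul_ite, mul_zero, show n - T.card = (A.card - T.card) + 1 by omega]
    congr 1
    ring
  · rw [← Finset.sum_sub_distrib, ← Finset.sum_add_distrib, Finset.mul_sum]
    refine Finset.sum_congr rfl fun T hT => ?_
    have hle := Finset.card_le_card (Finset.mem_powerset.1 hT)
    have hvT : v ∉ T := fun h => hvA (Finset.mem_powerset.1 hT h)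
    rw [Finset.card_insert_of_notMem hvT, hAc]
    rcases T.eq_empty_or_nonempty with rfl | hne
    · have c1 : (G.induce ((insert v ∅ : Finset (Fin n)) : Set (Fin n))).Connected := by
        have : Nonempty ((insert v ∅ : Finset (Fin n)) : Set (Fin n)) := ⟨⟨v, by simp⟩⟩
        refine ⟨fun a b => ?_⟩
        have ha := a.2
        have hb := b.2
        simp at ha hb
        rw [Subtype.ext (ha.trans hb.symm)]
      have c2 : ∀ H : SimpleGraph (Fin n),
          ¬ (H.induce ((∅ : Finset (Fin n)) : Set (Fin n))).Connected := by
        intro H h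
        obtain ⟨x⟩ := h.nonempty
        simpa using x.2
      rw [if_pos c1, if_neg (c2 _), if_neg (c2 _)]
      simp
    · simp only [key1 G v T hvT hne, hne.ne_empty, if_false]
      by_cases hN : ∀ u ∈ T, ¬ G.Adj v u
      · have : ¬ ∃ u ∈ T, G.Adj v u := by push Not; exact hN
        have hTB : T.card ≤ B.card := by
          apply Finset.card_le_card
          intro x hx
          exact Finset.mem_filter.2 ⟨Finset.mem_powerset.1 hT hx, hN x hx⟩
        rw [if_pos hN, if_neg (fun h => this h.2)]
        simp only [key2 G v T hN]
        split_ifs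
        · rw [show n - 1 - T.card = d + (B.card - T.card) by omega, pow_add]
          ring
        · simp
      · have : ∃ u ∈ T, G.Adj v u := by push Not at hN; exact hN
        rw [if_neg hN]
        simp only [this, and_true]
        split_ifs
        · rw [show n - (T.card + 1) = n - 1 - T.card by omega]
          ring
        · simp
end

section
/- Let G be a finite simple graph and let v be a vertex of G. Then the connected set polynomials satisfy the identity CS(G,x) = CS(G-v,x) + x·( CS(G/v,x) − CS(G-N[v],x) + 1 ) as polynomials (over the integers), where the connected set polynomial of a graph with empty vertex set is 0. -/
open SimpleGraph Polynomial

/-- The connected set polynomial `CS(G,x) = Σ_{k≥1} S_k(G) x^k` (over `ℤ`).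
(For a graph with empty vertex set this is `0`.) -/
noncomputable def CSpoly {V : Type} (G : SimpleGraph V) : Polynomial ℤ :=
  ∑ k ∈ Finset.Icc 1 (Nat.card V), Polynomial.C (connCount G k : ℤ) * Polynomial.X ^ k

def Cn {V : Type} (r : V → V → Prop) (S : Set V) : Prop :=
  S.Nonempty ∧ ∀ A : Set V, A ⊆ S → A.Nonempty → (∃ b ∈ S, b ∉ A) →
    ∃ a ∈ A, ∃ b ∈ S, b ∉ A ∧ r a b

lemma conn_iff_Cn {V : Type} (G : SimpleGraph V) (S : Set V) :
    (G.induce S).Connected ↔ Cn G.Adj S := by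
  constructor
  · intro h
    refine ⟨?_, ?_⟩
    · obtain ⟨x⟩ := h.nonempty
      exact ⟨x.1, x.2⟩
    · rintro A hA ⟨a, ha⟩ ⟨b, hb, hbA⟩
      by_contra hcon
      push Not at hcon
      have key : ∀ (x y : S), (G.induce S).Walk x y → x.1 ∈ A → y.1 ∈ A := by
        intro x y w
        induction w with
        | nil => exact id
        | @cons u v' w' hadj _ ih =>
          intro hu
          apply ih
          by_contra hv
          exact hcon _ hu _ v'.2 hv hadj
      obtain ⟨w⟩ := h.preconnected ⟨a, hA ha⟩ ⟨b, hb⟩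
      exact hbA (key _ _ w ha)
  · rintro ⟨⟨x, hx⟩, h⟩
    have : Nonempty S := ⟨⟨x, hx⟩⟩
    refine SimpleGraph.Connected.mk ?_
    intro a b
    by_contra hab
    obtain ⟨c, ⟨hcS, hc⟩, d, hd, hdA, hr⟩ :=
      h {y | ∃ hy : y ∈ S, (G.induce S).Reachable a ⟨y, hy⟩} (fun y hy => hy.1)
        ⟨a.1, a.2, SimpleGraph.Reachable.refl _⟩ ⟨b.1, b.2, fun hb => hab hb.2⟩
    apply hdA
    refine ⟨hd, hc.trans (SimpleGraph.Adj.reachable ?_)⟩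
    exact hr

open Classical in
lemma CSpoly_eq {V : Type} [Fintype V] (G : SimpleGraph V) :
    CSpoly G = ∑ S : Finset V, if Cn G.Adj (S : Set V) then (X : Polynomial ℤ) ^ S.card else 0 := by
  unfold CSpoly
  have h1 : ∀ k, (Polynomial.C (connCount G k : ℤ) * X ^ k : Polynomial ℤ)
      = ∑ S : Finset V, if S.card = k then
        (if Cn G.Adj (S : Set V) then (X : Polynomial ℤ) ^ S.card else 0) else 0 := by
    intro k
    have h2 : ∀ S : Finset V, (if S.card = k then
        (if Cn G.Adj (S : Set V) then (X : Polynomial ℤ) ^ S.card else 0) else 0)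
        = if (S.card = k ∧ Cn G.Adj (S : Set V)) then (X : Polynomial ℤ) ^ k else 0 := by
      intro S
      by_cases h : S.card = k <;> simp [h]
    simp_rw [h2]
    rw [← Finset.sum_filter, Finset.sum_const, connCount, Nat.card_eq_fintype_card,
      Fintype.card_subtype]
    simp_rw [conn_iff_Cn]
    simp
  simp_rw [h1]
  rw [Finset.sum_comm]
  refine Finset.sum_congr rfl fun S _ => ?_
  rw [Finset.sum_ite_eq]
  by_cases hS : Cn G.Adj (S : Set V)
  · have h0 : S.Nonempty := by simpa using hS.1
    have : S.card ∈ Finset.Icc 1 (Nat.card V) := by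
      rw [Finset.mem_Icc, Nat.card_eq_fintype_card]
      exact ⟨h0.card_pos, Finset.card_le_univ S⟩
    rw [if_pos this]
  · simp [hS]

lemma Cn_image {V : Type} (s : Set V) (q : s → s → Prop) (r : V → V → Prop)
    (h : ∀ a b : s, a ≠ b → (q a b ↔ r a b)) (S : Set s) :
    Cn q S ↔ Cn r (Subtype.val '' S) := by
  constructor
  · rintro ⟨h1, h2⟩
    refine ⟨h1.image _, ?_⟩
    rintro A hA ⟨a, ha⟩ ⟨b, ⟨b', hb', rfl⟩, hbA⟩
    obtain ⟨a', ha', rfl⟩ := hA ha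
    obtain ⟨c, hc, d, hd, hdA, hr⟩ := h2 (Subtype.val ⁻¹' A) (by
      intro x hx
      obtain ⟨y, hy, hyx⟩ := hA hx
      rwa [← Subtype.ext hyx]) ⟨a', ha⟩ ⟨b', hb', hbA⟩
    refine ⟨c, hc, d, ⟨d, hd, rfl⟩, hdA, (h c d ?_).1 hr⟩
    rintro rfl
    exact hdA hc
  · rintro ⟨h1, h2⟩
    refine ⟨by simpa using h1, ?_⟩
    rintro A hA ⟨a, ha⟩ ⟨b, hb, hbA⟩
    obtain ⟨_, ⟨c, hc, rfl⟩, _, ⟨d, hd, rfl⟩, hdA, hr⟩ := h2 (Subtype.val '' A)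
      (Set.image_mono hA) ⟨a, a, ha, rfl⟩ ⟨b, ⟨b, hb, rfl⟩, by
        rintro ⟨y, hy, hyb⟩
        exact hbA (Subtype.ext hyb ▸ hy)⟩
    have hdA' : d ∉ A := fun hd' => hdA ⟨d, hd', rfl⟩
    refine ⟨c, hc, d, hd, hdA', (h c d ?_).2 hr⟩
    rintro rfl
    exact hdA' hc

open Classical in
lemma CSpoly_sub {V : Type} [Fintype V] (s : Set V) (H : SimpleGraph s) (r : V → V → Prop)
    (h : ∀ a b : s, a ≠ b → (H.Adj a b ↔ r a b)) :
    CSpoly H = ∑ S : Finset V, if ((∀ x ∈ S, x ∈ s) ∧ Cn r (S : Set V)) then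
      (X : Polynomial ℤ) ^ S.card else 0 := by
  rw [CSpoly_eq, ← Finset.sum_filter, ← Finset.sum_filter]
  refine Finset.sum_bij (fun S _ => S.map (Function.Embedding.subtype _)) ?_ ?_ ?_ ?_
  · intro S hS
    have := (Cn_image s H.Adj r h S).1 (Finset.mem_filter.1 hS).2
    simp only [Finset.mem_filter, Finset.mem_univ, true_and]
    refine ⟨?_, ?_⟩
    · intro x hx
      obtain ⟨y, _, rfl⟩ := Finset.mem_map.1 hx
      exact y.2
    · rw [Finset.coe_map]
      exact this
  · intro S _ T _ hST
    exact Finset.map_injective _ hST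
  · intro S hS
    obtain ⟨h1, h2⟩ := (Finset.mem_filter.1 hS).2
    have hm : (S.subtype (· ∈ s)).map (Function.Embedding.subtype _) = S :=
      Finset.subtype_map_of_mem h1
    refine ⟨S.subtype (· ∈ s), ?_, hm⟩
    simp only [Finset.mem_filter, Finset.mem_univ, true_and]
    rw [Cn_image s H.Adj r h]
    rw [← hm, Finset.coe_map] at h2
    exact h2
  · intro S _
    rw [Finset.card_map]

lemma Cn_insert {V : Type} (G : SimpleGraph V) (v : V) (T : Set V) (hv : v ∉ T)
    (hT : T.Nonempty) :
    Cn G.Adj (insert v T) ↔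
      (Cn (fun a b => G.Adj a b ∨ (G.Adj v a ∧ G.Adj v b)) T ∧ ∃ x ∈ T, G.Adj v x) := by
  constructor
  · rintro ⟨-, h⟩
    refine ⟨⟨hT, ?_⟩, ?_⟩
    · intro A hA hAne ⟨b, hb, hbA⟩
      have hvA : v ∉ A := fun h => hv (hA h)
      obtain ⟨c, hc, d, hd, hdA, hr⟩ := h A (hA.trans (Set.subset_insert _ _)) hAne
        ⟨b, Or.inr hb, hbA⟩
      obtain ⟨c', hc', d', hd', hdA', hr'⟩ := h (insert v A) (Set.insert_subset_insert hA)
        ⟨v, Or.inl rfl⟩ ⟨b, Or.inr hb, by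
          rintro (rfl | h)
          · exact hv hb
          · exact hbA h⟩
      have hd'T : d' ∈ T := by
        rcases hd' with rfl | h
        · exact absurd (Or.inl rfl) hdA'
        · exact h
      have hd'A : d' ∉ A := fun h => hdA' (Or.inr h)
      rcases hd with rfl | hd
      · rcases hc' with rfl | hc'
        · exact ⟨c, hc, d', hd'T, hd'A, Or.inr ⟨hr.symm, hr'⟩⟩
        · exact ⟨c', hc', d', hd'T, hd'A, Or.inl hr'⟩
      · exact ⟨c, hc, d, hd, hdA, Or.inl hr⟩
    · obtain ⟨b, hb⟩ := hT
      obtain ⟨c, hc, d, hd, hdA, hr⟩ := h {v} (by simp) ⟨v, rfl⟩ ⟨b, Or.inr hb, by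
        rintro rfl
        exact hv hb⟩
      obtain rfl : c = v := hc
      rcases hd with rfl | hd
      · exact absurd rfl hdA
      · exact ⟨d, hd, hr⟩
  · rintro ⟨⟨-, h⟩, x, hx, hvx⟩
    refine ⟨⟨v, Or.inl rfl⟩, ?_⟩
    have key : ∀ A : Set V, A ⊆ T → A.Nonempty →
        ∃ a ∈ A, ∃ b ∈ insert v T, b ∉ A ∧ G.Adj a b := by
      intro A hA hAne
      have hvA : v ∉ A := fun h => hv (hA h)
      by_cases hAT : ∃ b ∈ T, b ∉ A
      · obtain ⟨a, ha, b, hb, hbA, hr | hr⟩ := h A hA hAne hAT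
        · exact ⟨a, ha, b, Or.inr hb, hbA, hr⟩
        · exact ⟨a, ha, v, Or.inl rfl, hvA, hr.1.symm⟩
      · push Not at hAT
        exact ⟨x, hAT x hx, v, Or.inl rfl, hvA, hvx.symm⟩
    intro A hA hAne ⟨b, hb, hbA⟩
    by_cases hvA : v ∈ A
    · obtain ⟨c, hc, d, hd, hdA, hr⟩ := key (insert v T \ A) (by
        rintro y ⟨rfl | hy, hyA⟩
        · exact absurd hvA hyA
        · exact hy) ⟨b, hb, hbA⟩
      refine ⟨d, ?_, c, hc.1, hc.2, hr.symm⟩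
      by_contra hdA'
      exact hdA ⟨hd, hdA'⟩
    · refine key A ?_ hAne
      intro y hy
      rcases hA hy with rfl | h
      · exact absurd hy hvA
      · exact h

lemma Cn_congr {V : Type} (r q : V → V → Prop) (T : Set V)
    (h : ∀ a ∈ T, ∀ b ∈ T, (r a b ↔ q a b)) : Cn r T ↔ Cn q T := by
  unfold Cn
  refine and_congr_right fun _ => forall_congr' fun A => forall_congr' fun hA =>
    forall_congr' fun _ => forall_congr' fun _ => ?_
  constructor
  · rintro ⟨a, ha, b, hb, hbA, hr⟩
    exact ⟨a, ha, b, hb, hbA, (h a (hA ha) b hb).1 hr⟩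
  · rintro ⟨a, ha, b, hb, hbA, hr⟩
    exact ⟨a, ha, b, hb, hbA, (h a (hA ha) b hb).2 hr⟩

lemma Cn_singleton {V : Type} (r : V → V → Prop) (v : V) : Cn r {v} := by
  refine ⟨⟨v, rfl⟩, ?_⟩
  rintro A hA ⟨a, ha⟩ ⟨b, rfl, hbA⟩
  obtain rfl : a = b := hA ha
  exact absurd ha hbA

/-- **Pivoting for the connected set polynomial**: for a finite simple graph `G` and a
vertex `v`, `CS(G,x) = CS(G-v,x) + x·(CS(G/v,x) − CS(G-N[v],x) + 1)` as polynomials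
over `ℤ`. -/
theorem cspoly_pivot {V : Type} [Fintype V] (G : SimpleGraph V) (v : V) :
    CSpoly G =
      CSpoly (delVert G v) +
        X * (CSpoly (pivotContract G v) - CSpoly (delClosedNbhd G v) + 1) := by
  classical
  rw [CSpoly_eq G, CSpoly_sub _ (delVert G v) G.Adj (fun a b _ => Iff.rfl),
    CSpoly_sub _ (delClosedNbhd G v) G.Adj (fun a b _ => Iff.rfl),
    CSpoly_sub _ (pivotContract G v) (fun a b => G.Adj a b ∨ (G.Adj v a ∧ G.Adj v b)) (by
      intro a b hab
      simp only [pivotContract, SimpleGraph.fromRel_adj]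
      constructor
      · rintro ⟨_, h | h | h⟩
        · exact h
        · exact Or.inl h.symm
        · exact Or.inr h.symm
      · exact fun h => ⟨hab, Or.inl h⟩)]
  have huniv : (Finset.univ : Finset (Finset V)) = (insert v (Finset.univ.erase v)).powerset := by
    rw [Finset.insert_erase (Finset.mem_univ v), Finset.powerset_univ]
  have hsplit : ∀ f : Finset V → Polynomial ℤ, ∑ S : Finset V, f S =
      ∑ S ∈ (Finset.univ.erase v).powerset, f S +
        ∑ S ∈ (Finset.univ.erase v).powerset, f (insert v S) := by
    intro f
    rw [huniv, Finset.sum_powerset_insert (Finset.notMem_erase v _)]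
  have hone : (1 : Polynomial ℤ) = ∑ S ∈ (Finset.univ.erase v).powerset,
      if S = ∅ then 1 else 0 := by
    rw [Finset.sum_ite_eq']
    simp
  rw [hone]
  have hsplit0 : ∀ f : Finset V → Polynomial ℤ, (∀ S, v ∈ S → f S = 0) → ∑ S : Finset V, f S =
      ∑ S ∈ (Finset.univ.erase v).powerset, f S := by
    intro f hf
    rw [hsplit, add_eq_left]
    exact Finset.sum_eq_zero fun S _ => hf _ (Finset.mem_insert_self _ _)
  rw [hsplit]
  rw [hsplit0, hsplit0, hsplit0]
  rotate_left
  · exact fun S hS => if_neg fun h => (h.1 v hS).2 rfl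
  · exact fun S hS => if_neg fun h => h.1 v hS rfl
  · exact fun S hS => if_neg fun h => h.1 v hS rfl
  congr 1
  · refine Finset.sum_congr rfl fun S hS => ?_
    have hne : ∀ x ∈ S, x ∈ {u : V | u ≠ v} := fun x hx =>
      Finset.ne_of_mem_erase (Finset.mem_powerset.1 hS hx)
    by_cases hc : Cn G.Adj (S : Set V)
    · rw [if_pos hc, if_pos ⟨hne, hc⟩]
    · rw [if_neg hc, if_neg (fun h => hc h.2)]
  · rw [← Finset.sum_sub_distrib, ← Finset.sum_add_distrib, Finset.mul_sum]
    refine Finset.sum_congr rfl fun S hS => ?_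
    have hne : ∀ x ∈ S, x ∈ {u : V | u ≠ v} := fun x hx =>
      Finset.ne_of_mem_erase (Finset.mem_powerset.1 hS hx)
    have hvS : v ∉ S := fun h => hne v h rfl
    rw [Finset.card_insert_of_notMem hvS, pow_succ', Finset.coe_insert]
    rcases S.eq_empty_or_nonempty with rfl | hSne
    · have h1 : ∀ r : V → V → Prop, ¬ Cn r (∅ : Set V) := fun r h => Set.not_nonempty_empty h.1
      simp [Cn_singleton, h1]
    · rw [Cn_insert G v S (by simpa using hvS) (by simpa using hSne)]
      rw [if_neg hSne.ne_empty, add_zero]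
      by_cases hx : ∃ x ∈ S, G.Adj v x
      · have h2 : ¬ (∀ x ∈ S, x ∈ {u : V | ¬ G.Adj v u ∧ u ≠ v}) := by
          obtain ⟨x, hx, hvx⟩ := hx
          exact fun h => (h x hx).1 hvx
        have hx' : ∃ x ∈ (S : Set V), G.Adj v x := hx
        by_cases hc : Cn (fun a b => G.Adj a b ∨ (G.Adj v a ∧ G.Adj v b)) (S : Set V)
        · rw [if_pos ⟨hc, hx'⟩, if_pos ⟨hne, hc⟩, if_neg (fun h => h2 h.1), sub_zero]
        · rw [if_neg (fun h => hc h.1), if_neg (fun h => hc h.2), if_neg (fun h => h2 h.1),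
            sub_zero, mul_zero]
      · have hx' : ¬ ∃ x ∈ (S : Set V), G.Adj v x := hx
        push Not at hx
        have h2 : ∀ x ∈ S, x ∈ {u : V | ¬ G.Adj v u ∧ u ≠ v} := fun x h => ⟨hx x h, hne x h⟩
        have h3 := Cn_congr (fun a b => G.Adj a b ∨ (G.Adj v a ∧ G.Adj v b)) G.Adj (S : Set V) (by
          intro a ha b hb
          simp [hx a ha])
        rw [if_neg (fun h => hx' h.2)]
        by_cases hc : Cn G.Adj (S : Set V)
        · rw [if_pos ⟨hne, h3.2 hc⟩, if_pos ⟨h2, hc⟩, sub_self, mul_zero]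
        · rw [if_neg (fun h => hc (h3.1 h.2)), if_neg (fun h => hc h.2), sub_self, mul_zero]
end

section
/- Let G and H be finite simple graphs, v a vertex of G and u a vertex of H, such that for every k ≥ 1: S_k(G−v) ≤ S_k(H−u), S_k(G/v) ≤ S_k(H/u), and S_k(H−N[u]) ≤ S_k(G−N[v]). Then S_k(G) ≤ S_k(H) for every k ≥ 1 (i.e., CS(G,x) ⪯ CS(H,x) coefficientwise). -/
open SimpleGraph

def CR {V : Type} (r : V → V → Prop) (S : Finset V) : Prop :=
  S.Nonempty ∧ ∀ P : V → Prop, (∀ a ∈ S, ∀ b ∈ S, a ≠ b → r a b → P a → P b) →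
    ∀ a ∈ S, ∀ b ∈ S, P a → P b

lemma connected_iff_pred {U : Type} (G : SimpleGraph U) :
    G.Connected ↔ Nonempty U ∧ ∀ P : U → Prop, (∀ a b, G.Adj a b → P a → P b) →
      ∀ a b, P a → P b := by
  constructor
  · intro h
    refine ⟨h.nonempty, fun P hP a b ha => ?_⟩
    obtain ⟨w⟩ := h.preconnected a b
    induction w with
    | nil => exact ha
    | cons hadj _ ih => exact ih (hP _ _ hadj ha)
  · rintro ⟨hne, h⟩
    haveI := hne
    refine SimpleGraph.Connected.mk (fun a b => ?_)
    exact h (fun x => G.Reachable a x) (fun x y hxy hx => hx.trans hxy.reachable) a b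
      (SimpleGraph.Reachable.refl _)

lemma CR_iff_sub {V : Type} (s : Set V) (G : SimpleGraph ↥s) (r : V → V → Prop)
    (hr : ∀ a b : ↥s, a ≠ b → (G.Adj a b ↔ r a.1 b.1)) (S : Finset ↥s) :
    (G.induce (S : Set ↥s)).Connected ↔ CR r (S.map (Function.Embedding.subtype _)) := by
  rw [connected_iff_pred]
  unfold CR
  refine and_congr ?_ ?_
  · simp [Finset.Nonempty]
  · constructor
    · intro h P hP a ha b hb hPa
      simp only [Finset.mem_map, Function.Embedding.subtype_apply] at ha hb hP
      obtain ⟨a, ha, rfl⟩ := ha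
      obtain ⟨b, hb, rfl⟩ := hb
      refine h (fun x => P x.1.1) ?_ ⟨a, ha⟩ ⟨b, hb⟩ hPa
      rintro ⟨x, hx⟩ ⟨y, hy⟩ hxy hPx
      have hxy' : G.Adj x y := hxy
      exact hP x.1 ⟨x, hx, rfl⟩ y.1 ⟨y, hy, rfl⟩ (fun h => hxy'.ne (Subtype.ext h))
        ((hr x y hxy'.ne).1 hxy') hPx
    · rintro h P hP ⟨a, ha⟩ ⟨b, hb⟩ hPa
      have := h (fun x => ∃ (h1 : x ∈ s) (h2 : (⟨x, h1⟩ : ↥s) ∈ S), P ⟨⟨x, h1⟩, h2⟩) ?_ a.1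
        (Finset.mem_map_of_mem _ ha) b.1 (Finset.mem_map_of_mem _ hb) ⟨a.2, ha, hPa⟩
      · obtain ⟨_, _, h⟩ := this
        exact h
      · intro x hx y hy hne hxy
        simp only [Finset.mem_map, Function.Embedding.subtype_apply] at hx hy
        obtain ⟨x, hx, rfl⟩ := hx
        obtain ⟨y, hy, rfl⟩ := hy
        rintro ⟨_, _, hp⟩
        refine ⟨y.2, hy, hP ⟨x, hx⟩ ⟨y, hy⟩ ?_ hp⟩
        exact (hr x y (fun h => hne (congrArg _ h))).2 hxy

lemma CR_iff {V : Type} (G : SimpleGraph V) (S : Finset V) :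
    (G.induce (S : Set V)).Connected ↔ CR G.Adj S := by
  rw [connected_iff_pred]
  unfold CR
  refine and_congr ?_ ?_
  · simp [Finset.Nonempty]
  · constructor
    · intro h P hP a ha b hb hPa
      refine h (fun x => P x.1) ?_ ⟨a, ha⟩ ⟨b, hb⟩ hPa
      rintro ⟨x, hx⟩ ⟨y, hy⟩ hxy hPx
      have hxy' : G.Adj x y := hxy
      exact hP x hx y hy hxy'.ne hxy' hPx
    · rintro h P hP ⟨a, ha⟩ ⟨b, hb⟩ hPa
      have := h (fun x => ∃ (h2 : x ∈ S), P ⟨x, h2⟩) ?_ a ha b hb ⟨ha, hPa⟩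
      · obtain ⟨_, h⟩ := this
        exact h
      · rintro x hx y hy hne hxy ⟨_, hp⟩
        exact ⟨hy, hP ⟨x, hx⟩ ⟨y, hy⟩ hxy hp⟩

lemma count_sub {V : Type} (s : Set V) (G : SimpleGraph ↥s) (r : V → V → Prop)
    (hr : ∀ a b : ↥s, a ≠ b → (G.Adj a b ↔ r a.1 b.1)) (k : ℕ) :
    connCount G k = {T : Finset V | (∀ x ∈ T, x ∈ s) ∧ T.card = k ∧ CR r T}.ncard := by
  classical
  unfold connCount
  refine Nat.card_congr (Equiv.ofBijective
    (fun S => ⟨S.1.map (Function.Embedding.subtype _), ?_, ?_, ?_⟩) ⟨?_, ?_⟩)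
  · intro x hx
    simp only [Finset.mem_map, Function.Embedding.subtype_apply] at hx
    obtain ⟨x, _, rfl⟩ := hx
    exact x.2
  · rw [Finset.card_map]; exact S.2.1
  · exact (CR_iff_sub s G r hr _).1 S.2.2
  · intro S T h
    exact Subtype.ext (Finset.map_injective _ (congrArg Subtype.val h))
  · rintro ⟨T, h1, h2, h3⟩
    have e : (T.subtype (· ∈ s)).map (Function.Embedding.subtype _) = T :=
      Finset.subtype_map_of_mem h1
    refine ⟨⟨T.subtype (· ∈ s), ?_, ?_⟩, Subtype.ext e⟩
    · rw [← h2, ← congrArg Finset.card e, Finset.card_map]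
    · rw [CR_iff_sub s G r hr, e]; exact h3

lemma count_all {V : Type} (G : SimpleGraph V) (k : ℕ) :
    connCount G k = {T : Finset V | T.card = k ∧ CR G.Adj T}.ncard := by
  unfold connCount
  simp only [CR_iff]
  rfl

lemma CR_congr {V : Type} {r r' : V → V → Prop} {T : Finset V}
    (h : ∀ a ∈ T, ∀ b ∈ T, (r a b ↔ r' a b)) : CR r T ↔ CR r' T := by
  unfold CR
  refine and_congr Iff.rfl (forall_congr' fun P => ?_)
  refine imp_congr ?_ Iff.rfl
  refine forall₂_congr fun a ha => forall₂_congr fun b hb => ?_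
  rw [h a ha b hb]

lemma CR_insert {V : Type} [DecidableEq V] (G : SimpleGraph V) (v : V) (T : Finset V)
    (hv : v ∉ T) (hT : ∃ x ∈ T, G.Adj v x) :
    CR G.Adj (insert v T) ↔ CR (fun a b => G.Adj a b ∨ (G.Adj v a ∧ G.Adj v b)) T := by
  obtain ⟨c, hc, hvc⟩ := hT
  constructor
  · rintro ⟨_, h⟩
    refine ⟨⟨c, hc⟩, fun P hP a ha b hb hPa => ?_⟩
    have := h (fun x => (x ≠ v → P x) ∧ (x = v → P c)) ?_ a (by simp [ha]) b (by simp [hb])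
      ⟨fun _ => hPa, fun h => absurd (h ▸ ha) hv⟩
    · exact this.1 (fun h => hv (h ▸ hb))
    · rintro x hx y hy hne hxy ⟨h1, h2⟩
      have key : ∀ a ∈ T, ∀ b ∈ T, G.Adj v a → G.Adj v b → P a → P b := by
        intro a ha b hb h1 h2 h3
        by_cases hab : a = b
        · exact hab ▸ h3
        · exact hP a ha b hb hab (Or.inr ⟨h1, h2⟩) h3
      rcases Finset.mem_insert.1 hx with rfl | hxT
      · rcases Finset.mem_insert.1 hy with rfl | hy
        · exact absurd rfl hne
        · exact ⟨fun _ => key c hc y hy hvc hxy (h2 rfl), fun h => absurd h.symm hne⟩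
      · have hxv : x ≠ v := fun h => hv (h ▸ hxT)
        rcases Finset.mem_insert.1 hy with rfl | hy
        · exact ⟨fun h => absurd rfl h, fun _ => key x hxT c hc hxy.symm hvc (h1 hxv)⟩
        · exact ⟨fun _ => hP x hxT y hy hne (Or.inl hxy) (h1 hxv),
            fun h => absurd (h ▸ hy) hv⟩
  · rintro ⟨_, h⟩
    refine ⟨⟨v, by simp⟩, fun P hP => ?_⟩
    have hcv : v ≠ c := hvc.ne
    have hP' : ∀ a ∈ insert v T, ∀ b ∈ insert v T, G.Adj a b → P a → P b :=
      fun a ha b hb hab => hP a ha b hb hab.ne hab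
    have key : ∀ a ∈ T, ∀ b ∈ T, P a → P b := by
      refine h P ?_
      rintro a ha b hb _ (hab | ⟨h1, h2⟩) hp
      · exact hP' a (by simp [ha]) b (by simp [hb]) hab hp
      · exact hP' v (by simp) b (by simp [hb]) h2
          (hP' a (by simp [ha]) v (by simp) h1.symm hp)
    have toC : ∀ a ∈ insert v T, P a → P c := by
      intro a ha hp
      rcases Finset.mem_insert.1 ha with rfl | ha
      · exact hP' _ (by simp) c (by simp [hc]) hvc hp
      · exact key a ha c hc hp
    intro a ha b hb hp
    have hpc := toC a ha hp
    rcases Finset.mem_insert.1 hb with rfl | hb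
    · exact hP' c (by simp [hc]) _ (by simp) hvc.symm hpc
    · exact key c hc b hb hpc

lemma touch_of_CR {V : Type} [DecidableEq V] (G : SimpleGraph V) (v : V) (T : Finset V)
    (hv : v ∉ T) (hT : T.Nonempty) (h : CR G.Adj (insert v T)) : ∃ x ∈ T, G.Adj v x := by
  by_contra hc
  push Not at hc
  obtain ⟨x, hx⟩ := hT
  have := h.2 (fun y => y = v) ?_ v (by simp) x (by simp [hx]) rfl
  · exact hv (this ▸ hx)
  · rintro a _ b hb hne hab rfl
    rcases Finset.mem_insert.1 hb with rfl | hb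
    · rfl
    · exact absurd hab (hc b hb)

lemma split_ncard {α : Type} [Finite α] (p q : α → Prop) :
    {x | p x}.ncard = {x | p x ∧ q x}.ncard + {x | p x ∧ ¬ q x}.ncard := by
  rw [← Set.ncard_inter_add_ncard_diff_eq_ncard {x | p x} {x | q x}]
  rfl

lemma count_with {V : Type} [Fintype V] [DecidableEq V] (G : SimpleGraph V) (v : V) (k : ℕ) :
    {T : Finset V | (T.card = k + 1 ∧ CR G.Adj T) ∧ v ∈ T}.ncard =
      {T : Finset V | v ∉ T ∧ T.card = k ∧ CR G.Adj (insert v T)}.ncard := by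
  symm
  refine Set.ncard_congr (fun T _ => insert v T) ?_ ?_ ?_
  · rintro T ⟨h1, h2, h3⟩
    exact ⟨⟨by rw [Finset.card_insert_of_notMem h1, h2], h3⟩, by simp⟩
  · rintro S T ⟨h1, _⟩ ⟨h2, _⟩ h
    rw [← Finset.erase_insert h1, h, Finset.erase_insert h2]
  · rintro T ⟨⟨h1, h2⟩, h3⟩
    refine ⟨T.erase v, ⟨by simp, ?_, ?_⟩, Finset.insert_erase h3⟩
    · rw [Finset.card_erase_of_mem h3, h1]; rfl
    · rwa [Finset.insert_erase h3]

lemma count_del {V : Type} (G : SimpleGraph V) (v : V) (k : ℕ) :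
    connCount (delVert G v) k =
      {T : Finset V | (T.card = k ∧ CR G.Adj T) ∧ v ∉ T}.ncard := by
  rw [count_sub _ (delVert G v) G.Adj (fun a b _ => Iff.rfl)]
  congr 1
  ext T
  have : (∀ x ∈ T, x ≠ v) ↔ v ∉ T :=
    ⟨fun h hv => h v hv rfl, fun h x hx e => h (e ▸ hx)⟩
  simp only [Set.mem_setOf_eq]
  rw [this]
  tauto

lemma recurrence {V : Type} [Fintype V] (G : SimpleGraph V) (v : V) (k : ℕ) (hk : 1 ≤ k) :
    connCount G (k + 1) + connCount (delClosedNbhd G v) k =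
      connCount (delVert G v) (k + 1) + connCount (pivotContract G v) k := by
  classical
  rw [count_del, count_all, split_ncard _ (fun T => v ∈ T), count_with,
    count_sub _ (delClosedNbhd G v) G.Adj (fun a b _ => Iff.rfl),
    count_sub _ (pivotContract G v) (fun a b => G.Adj a b ∨ (G.Adj v a ∧ G.Adj v b)),
    split_ncard (fun T : Finset V => (∀ x ∈ T, x ∈ {u : V | u ≠ v}) ∧ T.card = k ∧ CR _ T)
      (fun T => ∃ x ∈ T, G.Adj v x)]
  · have hmem : ∀ T : Finset V, (∀ x ∈ T, x ∈ {u : V | u ≠ v}) ↔ v ∉ T := fun T =>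
      ⟨fun h hv => h v hv rfl, fun h x hx e => h (e ▸ hx)⟩
    have e1 : {T : Finset V | v ∉ T ∧ T.card = k ∧ CR G.Adj (insert v T)} =
        {T : Finset V | ((∀ x ∈ T, x ∈ {u : V | u ≠ v}) ∧ T.card = k ∧
          CR (fun a b => G.Adj a b ∨ (G.Adj v a ∧ G.Adj v b)) T) ∧ ∃ x ∈ T, G.Adj v x} := by
      ext T
      simp only [Set.mem_setOf_eq]
      constructor
      · rintro ⟨h1, h2, h3⟩
        have ht := touch_of_CR G v T h1 (Finset.card_pos.1 (by omega)) h3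
        exact ⟨⟨(hmem T).2 h1, h2, (CR_insert G v T h1 ht).1 h3⟩, ht⟩
      · rintro ⟨⟨h1, h2, h3⟩, ht⟩
        have h1 := (hmem T).1 h1
        exact ⟨h1, h2, (CR_insert G v T h1 ht).2 h3⟩
    have e2 : {T : Finset V | (∀ x ∈ T, x ∈ {u : V | ¬ G.Adj v u ∧ u ≠ v}) ∧ T.card = k ∧
          CR G.Adj T} =
        {T : Finset V | ((∀ x ∈ T, x ∈ {u : V | u ≠ v}) ∧ T.card = k ∧
          CR (fun a b => G.Adj a b ∨ (G.Adj v a ∧ G.Adj v b)) T) ∧ ¬ ∃ x ∈ T, G.Adj v x} := by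
      ext T
      simp only [Set.mem_setOf_eq]
      have hc : (∀ x ∈ T, ¬ G.Adj v x) → (CR G.Adj T ↔
          CR (fun a b => G.Adj a b ∨ (G.Adj v a ∧ G.Adj v b)) T) := fun h =>
        CR_congr fun a ha b hb => by simp [h a ha]
      constructor
      · rintro ⟨h1, h2, h3⟩
        exact ⟨⟨fun x hx => (h1 x hx).2, h2, (hc fun x hx => (h1 x hx).1).1 h3⟩,
          fun ⟨x, hx, h⟩ => (h1 x hx).1 h⟩
      · rintro ⟨⟨h1, h2, h3⟩, h4⟩
        have h4 : ∀ x ∈ T, ¬ G.Adj v x := fun x hx h => h4 ⟨x, hx, h⟩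
        exact ⟨fun x hx => ⟨h4 x hx, h1 x hx⟩, h2, (hc h4).2 h3⟩
    rw [e1, e2]
    omega
  · intro a b hab
    simp only [pivotContract, SimpleGraph.fromRel_adj]
    have := G.adj_comm a.1 b.1
    tauto

lemma recurrence_one {V : Type} [Fintype V] (G : SimpleGraph V) (v : V) :
    connCount G 1 = connCount (delVert G v) 1 + 1 := by
  classical
  rw [count_del, count_all, split_ncard _ (fun T => v ∈ T), count_with G v 0, add_comm]
  congr 1
  rw [Set.ncard_eq_one]
  refine ⟨∅, ?_⟩
  ext T
  simp only [Set.mem_setOf_eq, Set.mem_singleton_iff, Finset.card_eq_zero]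
  constructor
  · exact fun h => h.2.1
  · rintro rfl
    refine ⟨by simp, rfl, ⟨v, by simp⟩, fun P _ a ha b hb hp => ?_⟩
    simp at ha hb
    subst ha hb
    exact hp

/-- If `v ∈ V(G)` and `u ∈ V(H)` satisfy `S_k(G−v) ≤ S_k(H−u)`, `S_k(G/v) ≤ S_k(H/u)`
and `S_k(H−N[u]) ≤ S_k(G−N[v])` for all `k ≥ 1`, then `S_k(G) ≤ S_k(H)` for all `k ≥ 1`,
i.e. `CS(G,x) ⪯ CS(H,x)` coefficientwise. -/
theorem connCount_le_of_pivot_comparisons {V W : Type} [Fintype V] [Fintype W]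
    (G : SimpleGraph V) (H : SimpleGraph W) (v : V) (u : W)
    (h1 : ∀ k, 1 ≤ k → connCount (delVert G v) k ≤ connCount (delVert H u) k)
    (h2 : ∀ k, 1 ≤ k → connCount (pivotContract G v) k ≤ connCount (pivotContract H u) k)
    (h3 : ∀ k, 1 ≤ k → connCount (delClosedNbhd H u) k ≤ connCount (delClosedNbhd G v) k) :
    ∀ k, 1 ≤ k → connCount G k ≤ connCount H k := by
  intro k hk
  obtain ⟨k, rfl⟩ : ∃ j, k = j + 1 := ⟨k - 1, by omega⟩
  have a1 := h1 (k + 1) (by omega)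
  rcases Nat.eq_zero_or_pos k with rfl | hpos
  · have := recurrence_one G v
    have := recurrence_one H u
    simp only [zero_add] at *
    omega
  · have := recurrence G v k hpos
    have := recurrence H u k hpos
    have := h2 k hpos
    have := h3 k hpos
    omega
end

section
/- For every n ≥ 5, the connected set counts of U_n are: S_1(U_n) = n, S_2(U_n) = n, and S_k(U_n) = C(n−1, k−1) for every k with 3 ≤ k ≤ n. -/
open SimpleGraph

/-- `U_n = (K_2 ∪ K̄_{n−3}) ∨ K_1`: on `{0,…,n−1}`, vertex `0` is adjacent to every other
vertex, vertices `1` and `2` are adjacent, and there are no other edges. -/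
def Ugraph (n : ℕ) : SimpleGraph (Fin n) :=
  SimpleGraph.fromRel (fun a b => a.val = 0 ∨ (a.val = 1 ∧ b.val = 2))

lemma conn_of_zero {n : ℕ} (S : Finset (Fin n)) (z : Fin n) (hz : z.val = 0) (h : z ∈ S) :
    ((Ugraph n).induce (S : Set (Fin n))).Connected := by
  rw [connected_iff_exists_forall_reachable]
  refine ⟨⟨z, h⟩, fun w => ?_⟩
  by_cases hw : (⟨z, h⟩ : (S : Set (Fin n))) = w
  · rw [hw]
  · apply Adj.reachable
    rw [comap_adj]
    refine (fromRel_adj _ _ _).2 ⟨fun e => hw (Subtype.ext e), Or.inl (Or.inl hz)⟩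

lemma conn_cases {n : ℕ} (S : Finset (Fin n)) (z a b : Fin n) (hz : z.val = 0)
    (ha : a.val = 1) (hb : b.val = 2) (hc : 2 ≤ S.card)
    (h : ((Ugraph n).induce (S : Set (Fin n))).Connected) (hzS : z ∉ S) : S = {a, b} := by
  have hab : a ≠ b := fun e => by rw [e] at ha; omega
  apply Finset.eq_of_subset_of_card_le
  · intro x hx
    have hnt : Nontrivial (S : Set (Fin n)) := by
      obtain ⟨p, hp, q, hq, hpq⟩ := Finset.one_lt_card.1 (show 1 < S.card by omega)
      exact ⟨⟨p, hp⟩, ⟨q, hq⟩, fun e => hpq (congrArg Subtype.val e)⟩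
    obtain ⟨y, hy⟩ := h.preconnected.exists_adj_of_nontrivial ⟨x, hx⟩
    rw [comap_adj] at hy
    have hy2 := ((fromRel_adj _ _ _).1 hy).2
    have hx0 : x.val ≠ 0 := fun e => hzS (by rwa [← Fin.ext (e.trans hz.symm)])
    have hy0 : y.1.val ≠ 0 := fun e => hzS (by
      have := y.2
      rwa [Fin.ext (e.trans hz.symm)] at this)
    simp only [Function.Embedding.subtype_apply] at hy2
    rw [Finset.mem_insert, Finset.mem_singleton, Fin.ext_iff, Fin.ext_iff]
    omega
  · rw [Finset.card_pair hab]; exact hc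

lemma conn_pair {n : ℕ} (a b : Fin n) (ha : a.val = 1) (hb : b.val = 2) :
    ((Ugraph n).induce (({a, b} : Finset (Fin n)) : Set (Fin n))).Connected := by
  have hab : a ≠ b := fun e => by rw [e] at ha; omega
  have := induce_pair_connected_of_adj (G := Ugraph n) (u := a) (v := b)
    ((fromRel_adj _ _ _).2 ⟨hab, Or.inl (Or.inr ⟨ha, hb⟩)⟩)
  rwa [Finset.coe_pair]

lemma count_zero {n : ℕ} (z : Fin n) (k : ℕ) (hk : 1 ≤ k) :
    ((Finset.univ : Finset (Finset (Fin n))).filter (fun S => S.card = k ∧ z ∈ S)).card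
      = (n - 1).choose (k - 1) := by
  have : (n - 1).choose (k - 1) =
      (Finset.powersetCard (k - 1) ((Finset.univ : Finset (Fin n)).erase z)).card := by
    simp
  rw [this]
  refine Finset.card_nbij' (fun S => S.erase z) (fun S => insert z S) ?_ ?_ ?_ ?_
  · intro S hS
    simp only [Finset.coe_filter, Set.mem_ofPred_eq, Finset.mem_univ, true_and] at hS
    simp only [Finset.mem_coe, Finset.mem_powersetCard]
    exact ⟨Finset.erase_subset_erase _ (Finset.subset_univ _),
      by rw [Finset.card_erase_of_mem hS.2, hS.1]⟩
  · intro S hS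
    simp only [Finset.mem_coe, Finset.mem_powersetCard] at hS
    have hz : z ∉ S := fun h => by simpa using hS.1 h
    simp only [Finset.coe_filter, Set.mem_ofPred_eq, Finset.mem_univ, true_and]
    exact ⟨by rw [Finset.card_insert_of_notMem hz]; omega, Finset.mem_insert_self _ _⟩
  · intro S hS
    simp only [Finset.coe_filter, Set.mem_ofPred_eq, Finset.mem_univ, true_and] at hS
    exact Finset.insert_erase hS.2
  · intro S hS
    simp only [Finset.mem_coe, Finset.mem_powersetCard] at hS
    have hz : z ∉ S := fun h => by simpa using hS.1 h
    exact Finset.erase_insert hz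

lemma connCount_eq {n : ℕ} (k : ℕ) (P : Finset (Fin n) → Prop) [DecidablePred P]
    (h : ∀ S : Finset (Fin n),
      (S.card = k ∧ ((Ugraph n).induce (S : Set (Fin n))).Connected) ↔ P S) :
    connCount (Ugraph n) k = (Finset.univ.filter P).card := by
  unfold connCount
  rw [Nat.card_congr (Equiv.subtypeEquivRight h), Nat.card_eq_fintype_card, Fintype.card_subtype]

/-- For `n ≥ 5`: `S_1(U_n) = n`, `S_2(U_n) = n`, and `S_k(U_n) = C(n−1,k−1)` for
`3 ≤ k ≤ n`. -/
theorem connCount_Ugraph (n : ℕ) (hn : 5 ≤ n) :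
    connCount (Ugraph n) 1 = n ∧ connCount (Ugraph n) 2 = n ∧
      ∀ k, 3 ≤ k → k ≤ n → connCount (Ugraph n) k = (n - 1).choose (k - 1) := by
  let z : Fin n := ⟨0, by omega⟩
  let a : Fin n := ⟨1, by omega⟩
  let b : Fin n := ⟨2, by omega⟩
  have hab : a ≠ b := fun e => by simp [a, b] at e
  have hzp : z ∉ ({a, b} : Finset (Fin n)) := by simp [z, a, b]
  refine ⟨?_, ?_, ?_⟩
  · rw [connCount_eq 1 (fun S => S.card = 1)]
    · have : (Finset.univ.filter (fun S : Finset (Fin n) => S.card = 1))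
          = Finset.powersetCard 1 Finset.univ := by
        ext S; simp [Finset.mem_powersetCard]
      rw [this]; simp
    · intro S
      refine ⟨fun h => h.1, fun h => ⟨h, ?_⟩⟩
      obtain ⟨x, rfl⟩ := Finset.card_eq_one.1 h
      rw [Finset.coe_singleton]
      rw [induce_singleton_eq_top]
      exact connected_top
  · rw [connCount_eq 2 (fun S => (S.card = 2 ∧ z ∈ S) ∨ S = {a, b})]
    · rw [Finset.filter_or, Finset.card_union_of_disjoint, count_zero z 2 (by omega)]
      · rw [Finset.filter_eq']
        simp
        omega
      · rw [Finset.disjoint_filter]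
        rintro S - h rfl
        exact hzp h.2
    · intro S
      constructor
      · rintro ⟨h1, h2⟩
        by_cases hz : z ∈ S
        · exact Or.inl ⟨h1, hz⟩
        · exact Or.inr (conn_cases S z a b rfl rfl rfl h1.ge h2 hz)
      · rintro (⟨h1, h2⟩ | rfl)
        · exact ⟨h1, conn_of_zero S z rfl h2⟩
        · exact ⟨Finset.card_pair hab, conn_pair a b rfl rfl⟩
  · intro k hk _
    rw [connCount_eq k (fun S => S.card = k ∧ z ∈ S), count_zero z k (by omega)]
    intro S
    refine ⟨fun ⟨h1, h2⟩ => ⟨h1, ?_⟩, fun ⟨h1, h2⟩ => ⟨h1, conn_of_zero S z rfl h2⟩⟩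
    by_contra hz
    have := conn_cases S z a b rfl rfl rfl (by omega) h2 hz
    rw [this, Finset.card_pair hab] at h1
    omega
end

section
/- For every n ≥ 5, the connected set counts of B_n are: S_1(B_n) = n, S_2(B_n) = n+1, S_3(B_n) = C(n−1, 2) + 1, and S_k(B_n) = C(n−1, k−1) for every k with 4 ≤ k ≤ n. -/
open SimpleGraph

/-- `B_n`: on `{0,…,n−1}`, vertex `0` is adjacent to each of `1,…,n−2`, vertices `1` and
`2` are adjacent, vertex `n−1` is adjacent to vertices `0` and `1`, and there are no other
edges. -/
def Bgraph (n : ℕ) : SimpleGraph (Fin n) :=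
  SimpleGraph.fromRel (fun a b =>
    a.val = 0 ∨ (a.val = 1 ∧ b.val = 2) ∨ (a.val = n - 1 ∧ b.val = 1))


lemma hub_conn {V : Type} (G : SimpleGraph V) (S : Finset V) (a : V) (ha : a ∈ S)
    (h : ∀ b ∈ S, b ≠ a → G.Adj a b) : (G.induce (S : Set V)).Connected := by
  rw [SimpleGraph.connected_iff_exists_forall_reachable]
  refine ⟨⟨a, ha⟩, ?_⟩
  rintro ⟨b, hb⟩
  by_cases hab : b = a
  · subst hab; exact SimpleGraph.Reachable.refl _
  · apply SimpleGraph.Adj.reachable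
    simpa using h b hb hab

lemma conn_nbr {V : Type} (G : SimpleGraph V) (S : Finset V)
    (hc : (G.induce (S : Set V)).Connected) (h2 : 2 ≤ S.card) (a : V) (ha : a ∈ S) :
    ∃ b ∈ S, G.Adj a b := by
  obtain ⟨c, hcS, hca⟩ := Finset.exists_mem_ne (by omega : 1 < S.card) a
  obtain ⟨w⟩ := hc.preconnected ⟨a, ha⟩ ⟨c, hcS⟩
  cases w with
  | nil => exact absurd rfl hca
  | cons h p =>
    rename_i v
    exact ⟨v.1, v.2, by simpa using h⟩

lemma star_card {V : Type} [DecidableEq V] (a : V) (T : Finset V) (haT : a ∉ T) (j : ℕ) :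
    ((T.powersetCard j).image (insert a)).card = T.card.choose j := by
  rw [Finset.card_image_of_injOn, Finset.card_powersetCard]
  intro A hA B hB hAB
  rw [Finset.mem_coe, Finset.mem_powersetCard] at hA hB
  have h1 : a ∉ A := fun h => haT (hA.1 h)
  have h2 : a ∉ B := fun h => haT (hB.1 h)
  rw [← Finset.erase_insert h1, ← Finset.erase_insert h2]
  exact congrArg (fun s => s.erase a) hAB

lemma star_mem {V : Type} [DecidableEq V] (a : V) (T : Finset V) (haT : a ∉ T) (j : ℕ)
    (S : Finset V) : S ∈ (T.powersetCard j).image (insert a) ↔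
      a ∈ S ∧ S ⊆ insert a T ∧ S.card = j + 1 := by
  simp only [Finset.mem_image, Finset.mem_powersetCard]
  constructor
  · rintro ⟨A, ⟨hA, hj⟩, rfl⟩
    refine ⟨Finset.mem_insert_self _ _, Finset.insert_subset_insert _ hA, ?_⟩
    rw [Finset.card_insert_of_notMem (fun h => haT (hA h)), hj]
  · rintro ⟨ha, hS, hj⟩
    refine ⟨S.erase a, ⟨?_, ?_⟩, Finset.insert_erase ha⟩
    · intro x hx
      have := hS (Finset.mem_of_mem_erase hx)
      exact (Finset.mem_insert.1 this).resolve_left (Finset.ne_of_mem_erase hx)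
    · rw [Finset.card_erase_of_mem ha]; omega

lemma count_split (n : ℕ) (hn : 5 ≤ n) (j : ℕ) (E : Finset (Finset (Fin n)))
    (hE : ∀ S, S ∈ E ↔ (⟨0, by omega⟩ : Fin n) ∉ S ∧ S.card = j + 1 ∧
      ((Bgraph n).induce (S : Set (Fin n))).Connected) :
    connCount (Bgraph n) (j + 1) = (n - 1).choose j + E.card := by
  classical
  set z : Fin n := ⟨0, by omega⟩ with hz
  have hzT : z ∉ Finset.univ.erase z := by simp
  have hcard : (Finset.univ.erase z).card = n - 1 := by simp
  rw [← hcard, ← star_card z _ hzT, ← Finset.card_union_of_disjoint]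
  · unfold connCount
    apply Nat.subtype_card
    intro S
    rw [Finset.mem_union, star_mem z _ hzT, hE]
    constructor
    · rintro (⟨h1, -, h3⟩ | ⟨-, h2, h3⟩)
      · refine ⟨h3, hub_conn _ S z h1 ?_⟩
        intro b hb hbz
        simp only [Bgraph, SimpleGraph.fromRel_adj]
        exact ⟨hbz.symm, Or.inl (Or.inl rfl)⟩
      · exact ⟨h2, h3⟩
    · rintro ⟨h2, h3⟩
      by_cases h : z ∈ S
      · exact Or.inl ⟨h, by rw [Finset.insert_erase (Finset.mem_univ _)]; exact Finset.subset_univ _, h2⟩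
      · exact Or.inr ⟨h, h2, h3⟩
  · rw [Finset.disjoint_left]
    intro S h1 h2
    exact ((hE S).1 h2).1 ((star_mem z _ hzT _ S).1 h1).1

lemma conn_iff (n : ℕ) (hn : 5 ≤ n) (S : Finset (Fin n)) (hz : (⟨0, by omega⟩ : Fin n) ∉ S)
    (h2 : 2 ≤ S.card) :
    ((Bgraph n).induce (S : Set (Fin n))).Connected ↔
      (⟨1, by omega⟩ : Fin n) ∈ S ∧
      S ⊆ insert ⟨1, by omega⟩ {⟨2, by omega⟩, ⟨n - 1, by omega⟩} := by
  have hne : ∀ b ∈ S, b.val ≠ 0 := by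
    intro b hb h0
    exact hz (by convert hb; exact h0.symm)
  constructor
  · intro hc
    have key : ∀ a ∈ S, ∃ b ∈ S, (a.val = 1 ∧ (b.val = 2 ∨ b.val = n - 1)) ∨
        (b.val = 1 ∧ (a.val = 2 ∨ a.val = n - 1)) := by
      intro a ha
      obtain ⟨b, hb, hab⟩ := conn_nbr _ S hc h2 a ha
      refine ⟨b, hb, ?_⟩
      have := hne a ha
      have := hne b hb
      simp only [Bgraph, SimpleGraph.fromRel_adj] at hab
      omega
    constructor
    · obtain ⟨a, ha⟩ := Finset.card_pos.1 (by omega : 0 < S.card)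
      obtain ⟨b, hb, h | h⟩ := key a ha
      · convert ha; exact h.1.symm
      · convert hb; exact h.1.symm
    · intro a ha
      obtain ⟨b, hb, h⟩ := key a ha
      simp only [Finset.mem_insert, Finset.mem_singleton, Fin.ext_iff]
      omega
  · rintro ⟨h1, hS⟩
    refine hub_conn _ S _ h1 ?_
    intro b hb hb1
    have := hS hb
    simp only [Finset.mem_insert, Finset.mem_singleton, Fin.ext_iff] at this
    simp only [Bgraph, SimpleGraph.fromRel_adj, ne_eq, Fin.ext_iff] at hb1 ⊢
    grind

lemma count_big (n : ℕ) (hn : 5 ≤ n) (j : ℕ) (hj : 1 ≤ j) :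
    connCount (Bgraph n) (j + 1) = (n - 1).choose j + Nat.choose 2 j := by
  have hT : (⟨1, by omega⟩ : Fin n) ∉
      ({⟨2, by omega⟩, ⟨n - 1, by omega⟩} : Finset (Fin n)) := by
    simp only [Finset.mem_insert, Finset.mem_singleton, Fin.ext_iff]; omega
  have hTc : ({⟨2, by omega⟩, ⟨n - 1, by omega⟩} : Finset (Fin n)).card = 2 := by
    apply Finset.card_pair
    simp only [ne_eq, Fin.ext_iff]; omega
  rw [count_split n hn j _ (fun S => ?_), star_card _ _ hT, hTc]
  rw [star_mem _ _ hT]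
  constructor
  · rintro ⟨h1, hS, hc⟩
    have hz : (⟨0, by omega⟩ : Fin n) ∉ S := by
      intro h
      have := hS h
      simp only [Finset.mem_insert, Finset.mem_singleton, Fin.ext_iff] at this
      omega
    exact ⟨hz, hc, (conn_iff n hn S hz (by omega)).2 ⟨h1, hS⟩⟩
  · rintro ⟨hz, hc, hcon⟩
    have := (conn_iff n hn S hz (by omega)).1 hcon
    exact ⟨this.1, this.2, hc⟩

lemma count_one (n : ℕ) (hn : 5 ≤ n) : connCount (Bgraph n) 1 = n := by
  rw [count_split n hn 0 (Finset.powersetCard 1 (Finset.univ.erase ⟨0, by omega⟩)) (fun S => ?_)]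
  · simp; omega
  · rw [Finset.mem_powersetCard]
    constructor
    · rintro ⟨hS, hc⟩
      refine ⟨fun h => by simpa using hS h, hc, ?_⟩
      obtain ⟨a, rfl⟩ := Finset.card_eq_one.1 hc
      exact hub_conn _ _ a (by simp) (by simp)
    · rintro ⟨hz, hc, -⟩
      exact ⟨fun x hx => Finset.mem_erase.2 ⟨fun h => hz (h ▸ hx), Finset.mem_univ _⟩, hc⟩

/-- For `n ≥ 5`: `S_1(B_n) = n`, `S_2(B_n) = n+1`, `S_3(B_n) = C(n−1,2) + 1`, and
`S_k(B_n) = C(n−1,k−1)` for `4 ≤ k ≤ n`. -/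
theorem connCount_Bgraph (n : ℕ) (hn : 5 ≤ n) :
    connCount (Bgraph n) 1 = n ∧ connCount (Bgraph n) 2 = n + 1 ∧
      connCount (Bgraph n) 3 = (n - 1).choose 2 + 1 ∧
      ∀ k, 4 ≤ k → k ≤ n → connCount (Bgraph n) k = (n - 1).choose (k - 1) := by
  refine ⟨count_one n hn, ?_, ?_, ?_⟩
  · rw [count_big n hn 1 le_rfl]; simp; omega
  · rw [count_big n hn 2 (by omega)]; simp
  · intro k hk _
    obtain ⟨j, rfl⟩ : ∃ j, k = j + 1 := ⟨k - 1, by omega⟩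
    rw [count_big n hn j (by omega), Nat.choose_eq_zero_of_lt (by omega : 2 < j)]
    simp
end

section
/- For every n ≥ 5, the connected set counts of F(n−5,0) are: S_1(F(n−5,0)) = n, S_2(F(n−5,0)) = n+1, and S_k(F(n−5,0)) = C(n−1, k−1) for every k with 3 ≤ k ≤ n. -/
open SimpleGraph

/-- `F(n−5,0)`: on `{0,…,n−1}`, vertex `0` is adjacent to every other vertex and the only
other edges are `{1,2}` and `{3,4}` (the star `K_{1,n−1}` with two disjoint pairs of
leaves joined by edges). -/
def Fgraph0 (n : ℕ) : SimpleGraph (Fin n) :=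
  SimpleGraph.fromRel (fun a b =>
    a.val = 0 ∨ (a.val = 1 ∧ b.val = 2) ∨ (a.val = 3 ∧ b.val = 4))

lemma aux_conn_iff (m : ℕ) (S : Finset (Fin (m+5))) :
    ((Fgraph0 (m+5)).induce (S : Set (Fin (m+5)))).Connected ↔
      ((0 : Fin (m+5)) ∈ S ∨ S.card = 1 ∨ S = {⟨1, by omega⟩, ⟨2, by omega⟩} ∨
        S = {⟨3, by omega⟩, ⟨4, by omega⟩}) := by
  constructor
  · intro h
    by_contra! hc
    obtain ⟨h0, h1, h2, h3⟩ := hc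
    let f : Fin (m+5) → ℕ := fun x => if x.val = 2 then 1 else if x.val = 4 then 3 else x.val
    have hadj : ∀ a b : (S : Set (Fin (m+5))),
        ((Fgraph0 (m+5)).induce (S : Set (Fin (m+5)))).Adj a b → f a = f b := by
      rintro ⟨a, ha⟩ ⟨b, hb⟩ hab
      have ha0 : a.val ≠ 0 := by
        intro h'; apply h0; have : a = 0 := Fin.ext h'
        rw [← this]; exact ha
      have hb0 : b.val ≠ 0 := by
        intro h'; apply h0; have : b = 0 := Fin.ext h'
        rw [← this]; exact hb
      simp only [Fgraph0, comap_adj, fromRel_adj, Function.Embedding.subtype_apply] at hab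
      simp only [f]
      split_ifs <;> omega
    have hall : ∀ a b : (S : Set (Fin (m+5))), f a = f b := by
      intro a b
      obtain ⟨w⟩ := h.preconnected a b
      induction w with
      | nil => rfl
      | cons hh _ ih => exact (hadj _ _ hh).trans ih
    obtain ⟨⟨a, ha⟩⟩ := h.nonempty
    have ha : a ∈ S := ha
    have hne : ∃ b ∈ S, b ≠ a := by
      by_contra! hb
      apply h1
      rw [Finset.card_eq_one]
      exact ⟨a, Finset.eq_singleton_iff_unique_mem.2 ⟨ha, hb⟩⟩
    obtain ⟨b, hb, hba⟩ := hne
    have hall' : ∀ x ∈ S, f a = f x := fun x hx => hall ⟨a, ha⟩ ⟨x, hx⟩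
    have hba' : b.val ≠ a.val := fun h => hba (Fin.ext h)
    have hfb := hall' b hb
    simp only [f] at hall' hfb
    have key : (a.val = 1 ∧ b.val = 2) ∨ (a.val = 2 ∧ b.val = 1) ∨
        (a.val = 3 ∧ b.val = 4) ∨ (a.val = 4 ∧ b.val = 3) := by
      split_ifs at hfb <;> omega
    have mk : ∀ c d : Fin (m+5), c ∈ S → d ∈ S →
        (∀ x ∈ S, x.val = c.val ∨ x.val = d.val) → S = {c, d} := by
      intro c d hc hd hx
      ext x
      simp only [Finset.mem_insert, Finset.mem_singleton]
      constructor
      · intro h; exact (hx x h).imp (fun h => Fin.ext h) (fun h => Fin.ext h)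
      · rintro (rfl | rfl) <;> assumption
    rcases key with ⟨p, q⟩ | ⟨p, q⟩ | ⟨p, q⟩ | ⟨p, q⟩
    · apply h2
      have e1 : a = ⟨1, by omega⟩ := Fin.ext p
      have e2 : b = ⟨2, by omega⟩ := Fin.ext q
      rw [← e1, ← e2]
      refine mk a b ha hb fun x hx => ?_
      have := hall' x hx
      split_ifs at this <;> omega
    · apply h2
      have e1 : a = ⟨2, by omega⟩ := Fin.ext p
      have e2 : b = ⟨1, by omega⟩ := Fin.ext q
      rw [← e1, ← e2]
      refine mk b a hb ha fun x hx => ?_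
      have := hall' x hx
      split_ifs at this <;> omega
    · apply h3
      have e1 : a = ⟨3, by omega⟩ := Fin.ext p
      have e2 : b = ⟨4, by omega⟩ := Fin.ext q
      rw [← e1, ← e2]
      refine mk a b ha hb fun x hx => ?_
      have := hall' x hx
      split_ifs at this <;> omega
    · apply h3
      have e1 : a = ⟨4, by omega⟩ := Fin.ext p
      have e2 : b = ⟨3, by omega⟩ := Fin.ext q
      rw [← e1, ← e2]
      refine mk b a hb ha fun x hx => ?_
      have := hall' x hx
      split_ifs at this <;> omega
  · have star : ∀ c ∈ S, (∀ x ∈ S, x ≠ c → (Fgraph0 (m+5)).Adj c x) →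
        ((Fgraph0 (m+5)).induce (S : Set (Fin (m+5)))).Connected := by
      intro c hc hx
      rw [connected_iff_exists_forall_reachable]
      refine ⟨⟨c, hc⟩, ?_⟩
      rintro ⟨x, hxS⟩
      by_cases hxc : x = c
      · subst hxc; exact Reachable.refl _
      · apply Adj.reachable
        exact hx x hxS hxc
    rintro (h | h | h | h)
    · refine star 0 h fun x _ hx => ?_
      simp only [Fgraph0, fromRel_adj]
      exact ⟨hx.symm, Or.inl (Or.inl rfl)⟩
    · obtain ⟨c, hc⟩ := Finset.card_eq_one.1 h
      refine star c (by simp [hc]) fun x hx hxc => ?_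
      rw [hc, Finset.mem_singleton] at hx
      exact absurd hx hxc
    · refine star ⟨1, by omega⟩ (by simp [h]) fun x hx hxc => ?_
      rw [h, Finset.mem_insert, Finset.mem_singleton] at hx
      have := hx.resolve_left hxc
      subst this
      simp [Fgraph0, fromRel_adj]
    · refine star ⟨3, by omega⟩ (by simp [h]) fun x hx hxc => ?_
      rw [h, Finset.mem_insert, Finset.mem_singleton] at hx
      have := hx.resolve_left hxc
      subst this
      simp [Fgraph0, fromRel_adj]

lemma aux_count (m k : ℕ) :
    (Finset.univ.filter fun S : Finset (Fin (m+5)) => S.card = k + 1 ∧ (0 : Fin (m+5)) ∈ S).card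
      = (m+4).choose k := by
  have : (Finset.univ.filter fun S : Finset (Fin (m+5)) => S.card = k + 1 ∧ (0 : Fin (m+5)) ∈ S)
      = (Finset.powersetCard k (Finset.univ.erase (0 : Fin (m+5)))).image (insert 0) := by
    ext S
    simp only [Finset.mem_filter, Finset.mem_univ, true_and, Finset.mem_image,
      Finset.mem_powersetCard]
    constructor
    · rintro ⟨h1, h2⟩
      refine ⟨S.erase 0, ⟨Finset.erase_subset_erase _ (Finset.subset_univ _), ?_⟩,
        Finset.insert_erase h2⟩
      rw [Finset.card_erase_of_mem h2, h1]; rfl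
    · rintro ⟨T, ⟨h1, h2⟩, rfl⟩
      refine ⟨?_, Finset.mem_insert_self _ _⟩
      rw [Finset.card_insert_of_notMem, h2]
      intro h; simpa using h1 h
  rw [this, Finset.card_image_of_injOn, Finset.card_powersetCard,
    Finset.card_erase_of_mem (Finset.mem_univ _)]
  · simp
  · intro T hT U hU h
    simp only [Finset.mem_coe,
      Finset.mem_powersetCard] at hT hU
    have hT0 : (0 : Fin (m+5)) ∉ T := fun h => by simpa using hT.1 h
    have hU0 : (0 : Fin (m+5)) ∉ U := fun h => by simpa using hU.1 h
    rw [← Finset.erase_insert hT0, ← Finset.erase_insert hU0]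
    exact congrArg (fun s => Finset.erase s 0) h

lemma aux_connCount (m k : ℕ) :
    connCount (Fgraph0 (m+5)) k = (Finset.univ.filter fun S : Finset (Fin (m+5)) =>
      S.card = k ∧ ((0 : Fin (m+5)) ∈ S ∨ S.card = 1 ∨ S = {⟨1, by omega⟩, ⟨2, by omega⟩} ∨
        S = {⟨3, by omega⟩, ⟨4, by omega⟩})).card := by
  unfold connCount
  simp only [aux_conn_iff]
  rw [Nat.card_eq_fintype_card, Fintype.card_subtype]

/-- For `n ≥ 5`: `S_1(F(n−5,0)) = n`, `S_2(F(n−5,0)) = n+1`, and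
`S_k(F(n−5,0)) = C(n−1,k−1)` for `3 ≤ k ≤ n`. -/
theorem connCount_Fgraph0 (n : ℕ) (hn : 5 ≤ n) :
    connCount (Fgraph0 n) 1 = n ∧ connCount (Fgraph0 n) 2 = n + 1 ∧
      ∀ k, 3 ≤ k → k ≤ n → connCount (Fgraph0 n) k = (n - 1).choose (k - 1) := by
  obtain ⟨m, rfl⟩ : ∃ m, n = m + 5 := ⟨n - 5, by omega⟩
  have c12 : ({⟨1, by omega⟩, ⟨2, by omega⟩} : Finset (Fin (m+5))).card = 2 :=
    Finset.card_pair (by simp)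
  have c34 : ({⟨3, by omega⟩, ⟨4, by omega⟩} : Finset (Fin (m+5))).card = 2 :=
    Finset.card_pair (by simp)
  refine ⟨?_, ?_, ?_⟩
  · rw [aux_connCount]
    have : (Finset.univ.filter fun S : Finset (Fin (m+5)) =>
      S.card = 1 ∧ ((0 : Fin (m+5)) ∈ S ∨ S.card = 1 ∨ S = {⟨1, by omega⟩, ⟨2, by omega⟩} ∨
        S = {⟨3, by omega⟩, ⟨4, by omega⟩})) = Finset.powersetCard 1 Finset.univ := by
      ext S
      simp only [Finset.mem_filter, Finset.mem_univ, true_and, Finset.mem_powersetCard,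
        Finset.subset_univ]
      tauto
    rw [this, Finset.card_powersetCard]; simp
  · rw [aux_connCount]
    have : (Finset.univ.filter fun S : Finset (Fin (m+5)) =>
      S.card = 2 ∧ ((0 : Fin (m+5)) ∈ S ∨ S.card = 1 ∨ S = {⟨1, by omega⟩, ⟨2, by omega⟩} ∨
        S = {⟨3, by omega⟩, ⟨4, by omega⟩})) =
        insert {⟨1, by omega⟩, ⟨2, by omega⟩} (insert {⟨3, by omega⟩, ⟨4, by omega⟩}
        (Finset.univ.filter fun S : Finset (Fin (m+5)) =>
          S.card = 1 + 1 ∧ (0 : Fin (m+5)) ∈ S)) := by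
      ext S
      simp only [Finset.mem_filter, Finset.mem_univ, true_and, Finset.mem_insert]
      constructor
      · rintro ⟨h1, h | h | h | h⟩
        · exact Or.inr (Or.inr ⟨h1, h⟩)
        · omega
        · exact Or.inl h
        · exact Or.inr (Or.inl h)
      · rintro (h | h | h)
        · exact ⟨h ▸ c12, by tauto⟩
        · exact ⟨h ▸ c34, by tauto⟩
        · exact ⟨h.1, Or.inl h.2⟩
    rw [this, Finset.card_insert_of_notMem, Finset.card_insert_of_notMem, aux_count]
    · simp
    · simp [Fin.ext_iff]
    · simp only [Finset.mem_insert, Finset.mem_filter, not_or]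
      constructor
      · intro h
        have : (⟨1, by omega⟩ : Fin (m+5)) ∈
            ({⟨3, by omega⟩, ⟨4, by omega⟩} : Finset (Fin (m+5))) := by
          rw [← h]; simp
        simp at this
      · simp [Fin.ext_iff]
  · intro k hk _
    obtain ⟨j, rfl⟩ : ∃ j, k = j + 1 := ⟨k - 1, by omega⟩
    rw [aux_connCount, show m + 5 - 1 = m + 4 from rfl, Nat.add_sub_cancel, ← aux_count]
    congr 1
    ext S
    simp only [Finset.mem_filter, Finset.mem_univ, true_and]
    constructor
    · rintro ⟨h1, h | h | h | h⟩
      · exact ⟨h1, h⟩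
      · omega
      · rw [h, c12] at h1; omega
      · rw [h, c34] at h1; omega
    · exact fun h => ⟨h.1, Or.inl h.2⟩
end

section
/- For every integer n ≥ 5 and every real number x > 0, x^n + Σ_{k=3}^{n−1} ( C(n−1, k−1) − n )·x^k > 0. (This polynomial equals CW(U_n,x) − CW(C_n,x), the difference of the cop-win polynomials of U_n and C_n, and its positivity on (0,∞) yields NCRel(U_n,p) > NCRel(C_n,p) for all p ∈ (0,1].) -/
theorem choose_aux (m : ℕ) : ∀ j, 2 ≤ j → j ≤ m + 2 → m + 6 ≤ (m + 4).choose j := by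
  induction m with
  | zero =>
    intro j h1 h2
    have : j = 2 := by omega
    subst this
    decide
  | succ m ih =>
    intro j h1 h2
    obtain ⟨i, rfl⟩ : ∃ i, j = i + 1 := ⟨j - 1, by omega⟩
    have e : (m + 1 + 4).choose (i + 1) = (m + 4).choose i + (m + 4).choose (i + 1) :=
      Nat.choose_succ_succ (m + 4) i
    rw [e]
    by_cases hi : 2 ≤ i
    · have a := ih i hi (by omega)
      have b : 0 < (m + 4).choose (i + 1) := Nat.choose_pos (by omega)
      omega
    · have : i = 1 := by omega
      subst this
      have a := ih 2 le_rfl (by omega)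
      have b : (m + 4).choose 1 = m + 4 := Nat.choose_one_right _
      simp only [Nat.reduceAdd] at *
      omega

/-- For every integer `n ≥ 5` and every real `x > 0`,
`x^n + Σ_{k=3}^{n−1} (C(n−1,k−1) − n)·x^k > 0`.  (This polynomial equals
`CW(U_n,x) − CW(C_n,x)`.) -/
theorem cw_diff_pos (n : ℕ) (hn : 5 ≤ n) (x : ℝ) (hx : 0 < x) :
    0 < x ^ n + ∑ k ∈ Finset.Icc 3 (n - 1),
      (((n - 1).choose (k - 1) : ℝ) - (n : ℝ)) * x ^ k := by
  obtain ⟨m, rfl⟩ : ∃ m, n = m + 5 := ⟨n - 5, by omega⟩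
  have e : m + 5 - 1 = (m + 3) + 1 := by omega
  rw [e, Finset.sum_Icc_succ_top (by omega)]
  have key : ∀ k ∈ Finset.Icc 3 (m + 3),
      (1 : ℝ) ≤ ((m + 3 + 1).choose (k - 1) : ℝ) - ((m + 5 : ℕ) : ℝ) := by
    intro k hk
    rw [Finset.mem_Icc] at hk
    have h := choose_aux m (k - 1) (by omega) (by omega)
    have h' : ((m + 6 : ℕ) : ℝ) ≤ ((m + 4).choose (k - 1) : ℝ) := by exact_mod_cast h
    push_cast at h' ⊢
    linarith
  have hmem : m + 3 ∈ Finset.Icc 3 (m + 3) := by simp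
  have h1 := Finset.single_le_sum (f := fun k =>
      (((m + 3 + 1).choose (k - 1) : ℝ) - ((m + 5 : ℕ) : ℝ)) * x ^ k)
    (fun k hk => mul_nonneg (by linarith [key k hk]) (by positivity)) hmem
  have h2 := mul_le_mul_of_nonneg_right (key _ hmem) (pow_pos hx (m + 3)).le
  have h3 : ((m + 3 + 1).choose (m + 3 + 1 - 1) : ℝ) = m + 4 := by
    have : (m + 3 + 1).choose (m + 3 + 1 - 1) = m + 4 := Nat.choose_succ_self_right (m + 3)
    rw [this]; push_cast; ring
  rw [h3]
  have h4 : 0 < x ^ (m + 3) * (x ^ 2 - x + 1) :=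
    mul_pos (pow_pos hx _) (by nlinarith [sq_nonneg (x - 1)])
  have h5 : x ^ (m + 5) + ((m : ℝ) + 4 - ((m + 5 : ℕ) : ℝ)) * x ^ (m + 3 + 1) + 1 * x ^ (m + 3)
      = x ^ (m + 3) * (x ^ 2 - x + 1) := by
    push_cast; ring
  have h6 := h2.trans h1
  linarith
end

section
/- Let G be a unicyclic graph of order n ≥ 5 that is not isomorphic to the cycle C_n. Then NRel(G,p) ≤ NRel(U_n,p) for every p ∈ [0,1]. -/
open SimpleGraph

open scoped Fin.NatCast Fin.CommRing

open Classical in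
lemma connCount_eq_s10 {V : Type} [Fintype V] (G : SimpleGraph V) (k : ℕ) :
    connCount G k =
      (Finset.univ.filter (fun S : Finset V => S.card = k ∧ (G.induce (S : Set V)).Connected)).card := by
  unfold connCount
  rw [Nat.card_eq_fintype_card, Fintype.card_subtype]

lemma closed_univ {V : Type} {G : SimpleGraph V} (h : G.Preconnected) (P : V → Prop) (a : V) (ha : P a)
    (hc : ∀ x y, P x → G.Adj x y → P y) (b : V) : P b := by
  obtain ⟨w⟩ := h a b
  induction w with
  | nil => exact ha
  | cons hadj _ ih => exact ih (hc _ _ ha hadj)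

open Classical in
lemma two_regular_iso {V : Type} [Fintype V] (G : SimpleGraph V) (hconn : G.Connected)
    (hedges : G.edgeSet.ncard = Fintype.card V) (hreg : ∀ v, G.degree v = 2) :
    Nonempty (G ≃g cycleGraph (Fintype.card V)) := by
  have hnac : ¬ G.IsAcyclic := by
    intro hac
    have := (isTree_iff_connected_and_card (G := G)).1 ⟨hconn, hac⟩
    rw [Nat.card_coe_set_eq, hedges, Nat.card_eq_fintype_card] at this
    omega
  rw [isAcyclic_iff_free_cycleGraph] at hnac
  push Not at hnac
  obtain ⟨m, hm, hc⟩ := hnac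
  obtain ⟨f⟩ := hc
  have hnb : ∀ i y, G.Adj (f i) y → ∃ j, (cycleGraph m).Adj i j ∧ f j = y := by
    intro i y hy
    have hdeg : (cycleGraph m).degree i = 2 := by
      obtain ⟨t, rfl⟩ := Nat.exists_eq_add_of_le' hm
      exact cycleGraph_degree_three_le
    have hsub : ((cycleGraph m).neighborFinset i).image f = G.neighborFinset (f i) := by
      apply Finset.eq_of_subset_of_card_le
      · intro x hx
        simp only [Finset.mem_image, mem_neighborFinset] at hx ⊢
        obtain ⟨j, hj, rfl⟩ := hx
        exact f.toHom.map_adj hj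
      · rw [Finset.card_image_of_injective _ (show Function.Injective (fun x => f x) from f.injective), card_neighborFinset_eq_degree,
          card_neighborFinset_eq_degree, hreg, hdeg]
    have : y ∈ ((cycleGraph m).neighborFinset i).image f := by rw [hsub]; simpa using hy
    simpa using this
  have hsurj : Function.Surjective f := by
    intro b
    refine closed_univ hconn.preconnected (fun x => ∃ i, f i = x) (f ⟨0, by omega⟩) ⟨_, rfl⟩ ?_ b
    rintro x y ⟨i, rfl⟩ hxy
    obtain ⟨j, _, hj⟩ := hnb i y hxy
    exact ⟨j, hj⟩
  have hbij : Function.Bijective f := ⟨f.injective, hsurj⟩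
  have hcard : m = Fintype.card V := by
    simpa using Fintype.card_of_bijective hbij
  rw [← hcard]
  refine ⟨(RelIso.symm ⟨Equiv.ofBijective f hbij, ?_⟩)⟩
  intro a b
  simp only [Equiv.ofBijective_apply]
  constructor
  · intro h
    obtain ⟨j, hj, hjb⟩ := hnb a _ h
    rwa [← f.injective hjb]
  · intro h
    exact f.toHom.map_adj h

/-- arcs -/
lemma conn_arc {V : Type} [DecidableEq V] (H : SimpleGraph V) (t : ℕ) (f : Fin (t+1) → V)
    (hf : Function.Bijective f)
    (hadj : ∀ i y, H.Adj (f i) y → y = f (i+1) ∨ y = f (i-1))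
    (S : Finset V) (hS : (H.induce (S : Set V)).Connected) (hlt : S.card < t + 1) :
    ∃ a : Fin (t+1), S = (Finset.range S.card).image (fun i : ℕ => f (a + (i : Fin (t+1)))) := by
  classical
  obtain ⟨⟨x0, hx0⟩⟩ := hS.nonempty
  obtain ⟨c, rfl⟩ := hf.2 x0
  have hc : f c ∈ S := by simpa using hx0
  have h1 : ∃ a, f a ∈ S ∧ f (a - 1) ∉ S := by
    by_contra hcon
    push Not at hcon
    have hall : ∀ i : ℕ, f (c - (i : Fin (t+1))) ∈ S := by
      intro i
      induction i with
      | zero => simpa using hc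
      | succ i ih =>
        have := hcon _ ih
        rwa [sub_sub, ← Nat.cast_succ] at this
    have hsub : Finset.univ.image f ⊆ S := by
      intro y hy
      obtain ⟨b, -, rfl⟩ := Finset.mem_image.1 hy
      have := hall (c - b).val
      rwa [Fin.cast_val_eq_self, sub_sub_cancel] at this
    have := Finset.card_le_card hsub
    rw [Finset.card_image_of_injective _ hf.1] at this
    simp at this
    omega
  obtain ⟨a, ha, ha'⟩ := h1
  have hlast : f (a + ((t : ℕ) : Fin (t+1))) ∉ S := by
    have : ((t : ℕ) : Fin (t+1)) = -1 := by
      rw [eq_neg_iff_add_eq_zero]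
      have := Fin.natCast_self (t+1)
      push_cast at this
      exact this
    rw [this, ← sub_eq_add_neg]
    exact ha'
  have hex : ∃ j : ℕ, f (a + (j : Fin (t+1))) ∉ S := ⟨t, hlast⟩
  let j := Nat.find hex
  have hj : f (a + (j : Fin (t+1))) ∉ S := Nat.find_spec hex
  have hjmin : ∀ i < j, f (a + (i : Fin (t+1))) ∈ S := fun i hi => not_not.1 (Nat.find_min hex hi)
  have hjt : j ≤ t := Nat.find_min' hex hlast
  have hj0 : 0 < j := by
    rcases Nat.eq_zero_or_pos j with h | h
    · rw [h] at hj; simp at hj; exact absurd ha hj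
    · exact h
  have hSeq : S = (Finset.range j).image (fun i : ℕ => f (a + (i : Fin (t+1)))) := by
    apply Finset.Subset.antisymm
    · intro y hy
      have := closed_univ hS.preconnected
        (fun x => ∃ i < j, f (a + (i : Fin (t+1))) = x.1) ⟨f a, ha⟩ ⟨0, hj0, by simp⟩ ?_ ⟨y, hy⟩
      · obtain ⟨i, hi, h⟩ := this
        exact Finset.mem_image.2 ⟨i, Finset.mem_range.2 hi, h⟩
      · rintro ⟨x, hx⟩ ⟨z, hz⟩ ⟨i, hi, rfl⟩ hxz
        have hxz' : H.Adj (f (a + (i : Fin (t+1)))) z := hxz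
        have hz' : z ∈ S := hz
        rcases hadj _ _ hxz' with h | h
        · rw [add_assoc, ← Nat.cast_succ] at h
          have hne : i + 1 ≠ j := by
            intro h2
            rw [Nat.succ_eq_add_one, h2] at h
            exact hj (h ▸ hz')
          exact ⟨i+1, by omega, h.symm⟩
        · rcases i with _ | i
          · simp at h
            exact absurd (h ▸ hz') ha'
          · refine ⟨i, by omega, ?_⟩
            refine Eq.trans ?_ h.symm; congr 1; push_cast; ring
    · intro y hy
      obtain ⟨i, hi, rfl⟩ := Finset.mem_image.1 hy
      exact hjmin i (Finset.mem_range.1 hi)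
  have hcard : S.card = j := by
    rw [hSeq, Finset.card_image_of_injOn, Finset.card_range]
    intro x hx y hy hxy
    have h := add_left_cancel (hf.1 hxy)
    simp only [Finset.coe_range, Set.mem_Iio] at hx hy
    have := congrArg Fin.val h
    rwa [Fin.val_natCast, Fin.val_natCast, Nat.mod_eq_of_lt (by omega), Nat.mod_eq_of_lt (by omega)] at this
  exact ⟨a, by rw [hcard]; exact hSeq⟩

open Classical in
lemma cyc_counts {V : Type} [Fintype V] (H : SimpleGraph V) (m : ℕ) (hm : 3 ≤ m)
    (e : H ≃g cycleGraph m) (k : ℕ) (hk : k < m) :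
    connCount H k ≤ m ∧ ∀ u : V, (Finset.univ.filter (fun S : Finset V =>
      S.card = k ∧ (H.induce (S : Set V)).Connected ∧ u ∈ S)).card ≤ k := by
  obtain ⟨t, rfl⟩ := Nat.exists_eq_add_of_le' hm
  have hadj : ∀ i y, H.Adj (e.symm i) y → y = e.symm (i+1) ∨ y = e.symm (i-1) := by
    intro i y h
    have h2 : (cycleGraph (t+3)).Adj i (e y) := by
      rw [← e.map_adj_iff] at h; simpa using h
    rw [cycleGraph_adj] at h2
    rcases h2 with h2 | h2
    · right
      have : e y = i - 1 := by rw [← h2]; ring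
      rw [← this]; simp
    · left
      have : e y = i + 1 := by rw [← h2]; ring
      rw [← this]; simp
  have harc := conn_arc H (t+2) e.symm e.symm.bijective hadj
  constructor
  · rw [connCount_eq_s10]
    calc _ ≤ (Finset.univ.image (fun a : Fin (t+3) =>
          (Finset.range k).image (fun i : ℕ => e.symm (a + (i : Fin (t+3)))))).card := by
          apply Finset.card_le_card
          intro S hS
          simp only [Finset.mem_filter, Finset.mem_univ, true_and] at hS
          obtain ⟨a, ha⟩ := harc S hS.2 (by omega)
          rw [hS.1] at ha
          exact Finset.mem_image.2 ⟨a, Finset.mem_univ _, ha.symm⟩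
      _ ≤ _ := Finset.card_image_le
      _ = _ := by simp
  · intro u
    calc _ ≤ ((Finset.range k).image (fun j : ℕ =>
          (Finset.range k).image (fun i : ℕ => e.symm ((e u - (j : Fin (t+3))) + (i : Fin (t+3)))))).card := by
          apply Finset.card_le_card
          intro S hS
          simp only [Finset.mem_filter, Finset.mem_univ, true_and] at hS
          obtain ⟨a, ha⟩ := harc S hS.2.1 (by omega)
          rw [hS.1] at ha
          have hu := hS.2.2
          rw [ha] at hu
          obtain ⟨j, hj, hju⟩ := Finset.mem_image.1 hu
          refine Finset.mem_image.2 ⟨j, hj, ?_⟩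
          have : e u - (j : Fin (t+3)) = a := by rw [← hju]; simp
          simp only [this]
          exact ha.symm
      _ ≤ _ := Finset.card_image_le
      _ = _ := by simp

lemma choose_bound (m : ℕ) : ∀ j, 2 ≤ j → j + 2 ≤ m → 2 * m ≤ m.choose j + 2 := by
  induction m with
  | zero => intro j h1 h2; omega
  | succ m ih =>
    intro j h1 h2
    obtain ⟨i, rfl⟩ := Nat.exists_eq_add_of_le' h1
    rw [Nat.choose_succ_succ' m (i+1)]
    by_cases h : i + 2 + 2 ≤ m
    · have := ih (i+2) (by omega) h
      have h3 : m ≤ m.choose (i+1) := by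
        rcases Nat.eq_zero_or_pos i with rfl | hi
        · simp
        · have := ih (i+1) (by omega) (by omega)
          omega
      have : i + 1 + 1 = i + 2 := rfl
      rw [this]
      omega
    · have hm : m = i + 3 := by omega
      subst hm
      have h4 : (i+3).choose (i+1+1) = i + 3 := by
        rw [show i + 3 = (i+1+1) + 1 from rfl, Nat.choose_succ_self_right]
      rw [h4]
      rcases Nat.eq_zero_or_pos i with rfl | hi
      · simp
      · have := ih (i+1) (by omega) (by omega)
        omega

lemma restrict_conn {V : Type} (G : SimpleGraph V) (v u : V) (hv : ∀ w, G.Adj v w → w = u)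
    (S : Set V) (hS : (G.induce S).Connected) (T : Set ({v}ᶜ : Set V))
    (hT : ∀ x, x ∈ T ↔ x.1 ∈ S) (hne : T.Nonempty) :
    ((G.induce ({v}ᶜ : Set V)).induce T).Connected := by
  have h1 : ((G.induce S).induce {x : S | x.1 ≠ v}).Preconnected := by
    apply hS.preconnected.induce_of_degree_eq_one
    rintro ⟨x, hx⟩ hxv
    simp only [Set.mem_ofPred_eq, not_not] at hxv
    subst hxv
    rintro ⟨y, hy⟩ hy1 ⟨z, hz⟩ hz1
    have hy2 : G.Adj x y := hy1
    have hz2 : G.Adj x z := hz1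
    simp [hv _ hy2, hv _ hz2]
  let f : ((G.induce S).induce {x : S | x.1 ≠ v}) →g ((G.induce ({v}ᶜ : Set V)).induce T) :=
    { toFun := fun x => ⟨⟨x.1.1, x.2⟩, (hT _).2 x.1.2⟩
      map_rel' := fun {a b} h => h }
  have hf : Function.Surjective f := by
    rintro ⟨⟨x, hx⟩, hxT⟩
    exact ⟨⟨⟨x, (hT _).1 hxT⟩, hx⟩, rfl⟩
  have := hne.to_subtype
  exact ⟨h1.map f hf⟩

open Classical in
lemma leaf_split {V : Type} [Fintype V] (G : SimpleGraph V) (v u : V) (huv : G.Adj v u)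
    (hv : ∀ w, G.Adj v w → w = u) (k : ℕ) (hk : 3 ≤ k) :
    connCount G k ≤ connCount (G.induce ({v}ᶜ : Set V)) k +
      min ((Fintype.card V - 2).choose (k - 2))
       ((Finset.univ.filter (fun T : Finset ({v}ᶜ : Set V) =>
      T.card = k - 1 ∧ ((G.induce ({v}ᶜ : Set V)).induce (T : Set ({v}ᶜ : Set V))).Connected ∧
        (⟨u, huv.ne'⟩ : ({v}ᶜ : Set V)) ∈ T)).card) := by
  have humem : ∀ S : Finset V, S.card = k → (G.induce (S : Set V)).Connected → v ∈ S → u ∈ S := by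
    intro S hSk hS hvS
    by_contra hu
    have hall : ∀ x : (S : Set V), x.1 = v := by
      refine closed_univ hS.preconnected (fun x => x.1 = v) ⟨v, hvS⟩ rfl ?_
      rintro ⟨x, hx⟩ ⟨y, hy⟩ rfl hxy
      have : G.Adj x y := hxy
      rw [hv y this] at hy
      exact absurd hy hu
    have : S ⊆ {v} := fun x hx => by simpa using hall ⟨x, hx⟩
    have := Finset.card_le_card this
    simp at this
    omega
  have hsubT : ∀ (S : Finset V), ∀ x, x ∈ ((S.subtype (fun x => x ∈ ({v}ᶜ : Set V)) : Finset ({v}ᶜ : Set V)) : Set ({v}ᶜ : Set V)) ↔ x.1 ∈ (S : Set V) := by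
    intro S x
    simp
  have hcardT : ∀ S : Finset V, (S.subtype (fun x => x ∈ ({v}ᶜ : Set V))).card = (S.erase v).card := by
    intro S
    rw [Finset.card_subtype]
    congr 1
    ext x
    simp [and_comm]
  have hinj : ∀ S S' : Finset V, (v ∈ S ↔ v ∈ S') →
      S.subtype (fun x => x ∈ ({v}ᶜ : Set V)) = S'.subtype (fun x => x ∈ ({v}ᶜ : Set V)) → S = S' := by
    intro S S' h h2
    ext x
    by_cases hx : x = v
    · subst hx; exact h
    · have := Finset.ext_iff.1 h2 ⟨x, hx⟩
      simpa using this
  rw [connCount_eq_s10, ← Finset.card_filter_add_card_filter_not (p := fun S => v ∉ S)]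
  apply Nat.add_le_add
  · rw [connCount_eq_s10]
    apply Finset.card_le_card_of_injOn (fun S => S.subtype (fun x => x ∈ ({v}ᶜ : Set V)))
    · intro S hS
      simp only [Finset.coe_filter, Finset.mem_filter, Finset.mem_univ, true_and, Set.mem_ofPred_eq] at hS ⊢
      obtain ⟨⟨hSk, hS⟩, hvS⟩ := hS
      have hc : (S.subtype (fun x => x ∈ ({v}ᶜ : Set V))).card = k := by
        rw [hcardT, Finset.erase_eq_of_notMem hvS, hSk]
      refine ⟨hc, restrict_conn G v u hv _ hS _ (hsubT S) ?_⟩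
      rw [Finset.coe_nonempty, ← Finset.card_pos]; omega
    · intro S hS S' hS' h
      simp only [Finset.coe_filter, Finset.mem_filter, Finset.mem_univ, true_and, Set.mem_ofPred_eq] at hS hS'
      exact hinj S S' (by tauto) h
  · apply le_min
    · have : ((Finset.univ.erase v).erase u : Finset V).card = Fintype.card V - 2 := by
        rw [Finset.card_erase_of_mem (by simp [huv.ne']), Finset.card_erase_of_mem (by simp)]
        simp [Nat.sub_sub]
      rw [← this, ← Finset.card_powersetCard]
      apply Finset.card_le_card_of_injOn (fun S => (S.erase v).erase u)
      · intro S hS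
        simp only [Finset.coe_filter, Finset.mem_filter, Finset.mem_univ, true_and, Set.mem_ofPred_eq, not_not] at hS
        obtain ⟨⟨hSk, hS⟩, hvS⟩ := hS
        have hu := humem S hSk hS hvS
        simp only [Finset.mem_coe, Finset.mem_powersetCard]
        refine ⟨Finset.erase_subset_erase _ (Finset.erase_subset_erase _ (Finset.subset_univ _)), ?_⟩
        rw [Finset.card_erase_of_mem (by simp [huv.ne', hu]), Finset.card_erase_of_mem hvS]
        omega
      · intro S hS S' hS' h
        simp only [Finset.coe_filter, Finset.mem_filter, Finset.mem_univ, true_and, Set.mem_ofPred_eq, not_not] at hS hS'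
        have hu := humem S hS.1.1 hS.1.2 hS.2
        have hu' := humem S' hS'.1.1 hS'.1.2 hS'.2
        ext x
        have := Finset.ext_iff.1 h x
        simp only [Finset.mem_erase] at this
        by_cases h1 : x = v
        · subst h1; tauto
        · by_cases h2 : x = u
          · subst h2; tauto
          · tauto
    · apply Finset.card_le_card_of_injOn (fun S => S.subtype (fun x => x ∈ ({v}ᶜ : Set V)))
      · intro S hS
        simp only [Finset.coe_filter, Finset.mem_filter, Finset.mem_univ, true_and, Set.mem_ofPred_eq, not_not] at hS ⊢
        obtain ⟨⟨hSk, hS⟩, hvS⟩ := hS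
        have hc : (S.subtype (fun x => x ∈ ({v}ᶜ : Set V))).card = k - 1 := by
          rw [hcardT, Finset.card_erase_of_mem hvS, hSk]
        refine ⟨hc, restrict_conn G v u hv _ hS _ (hsubT S) ?_, ?_⟩
        · rw [Finset.coe_nonempty, ← Finset.card_pos]; omega
        · simpa using humem S hSk hS hvS
      · intro S hS S' hS' h
        simp only [Finset.coe_filter, Finset.mem_filter, Finset.mem_univ, true_and, Set.mem_ofPred_eq, not_not] at hS hS'
        exact hinj S S' (by tauto) h

open Classical in
lemma connCount_triv {V : Type} [Fintype V] (G : SimpleGraph V) (k : ℕ) :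
    connCount G k ≤ (Fintype.card V).choose k := by
  rw [connCount_eq_s10, ← Finset.card_univ, ← Finset.card_powersetCard]
  apply Finset.card_le_card
  intro S hS
  simp only [Finset.mem_filter, Finset.mem_univ, true_and] at hS
  simp [Finset.mem_powersetCard, hS.1]

open Classical in
lemma ncard_edge {V : Type} [Fintype V] (G : SimpleGraph V) : G.edgeSet.ncard = G.edgeFinset.card := by
  rw [Set.ncard_eq_toFinset_card']
  rfl

open Classical in
lemma main_bound (n : ℕ) : ∀ (V : Type) [Fintype V] (G : SimpleGraph V), Fintype.card V = n →
    G.Connected → G.edgeSet.ncard = n → ¬ Nonempty (G ≃g cycleGraph n) →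
    ∀ k, 3 ≤ k → connCount G k ≤ (n - 1).choose (k - 1) := by
  have three : ∀ (n : ℕ) (V : Type) [Fintype V] (G : SimpleGraph V), Fintype.card V = n →
    G.Connected → G.edgeSet.ncard = n → 3 ≤ n := by
    intro n V _ G hV hc he
    have h1 := G.card_edgeFinset_le_card_choose_two
    rw [← ncard_edge, he, hV] at h1
    have h2 : 0 < n := by
      have := hc.nonempty
      rw [← hV]; exact Fintype.card_pos
    by_contra h
    have : n = 1 ∨ n = 2 := by omega
    rcases this with rfl | rfl <;> simp at h1
  induction n with
  | zero =>
    intro V _ G hV hc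
    have := hc.nonempty
    have : 0 < Fintype.card V := Fintype.card_pos
    omega
  | succ n ih =>
    intro V _ G hV hc he hiso k hk
    have hn3 := three _ V G hV hc he
    have : Nontrivial V := Fintype.one_lt_card_iff_nontrivial.1 (by omega)
    have hleaf : ∃ v, G.degree v = 1 := by
      by_contra hno
      push Not at hno
      have h2 : ∀ v ∈ Finset.univ, 2 ≤ G.degree v := fun v _ => by
        have := hc.preconnected.degree_pos_of_nontrivial v
        have := hno v
        omega
      have hsum := G.sum_degrees_eq_twice_card_edges
      rw [← ncard_edge, he] at hsum
      have hs2 : ∑ v : V, 2 = ∑ v, G.degree v := by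
        rw [hsum]; simp [hV]; ring
      have := (Finset.sum_eq_sum_iff_of_le h2).1 hs2
      apply hiso
      rw [← hV]
      exact two_regular_iso G hc (by rw [he, hV]) (fun v => (this v (Finset.mem_univ v)).symm)
    obtain ⟨v, hvd⟩ := hleaf
    obtain ⟨u, huv, hu⟩ := degree_eq_one_iff_existsUnique_adj.mp hvd
    have hHc := hc.induce_compl_singleton_of_degree_eq_one hvd
    have hHV : Fintype.card ({v}ᶜ : Set V) = n := by
      rw [Fintype.card_compl_set]; simp [hV]
    have hHe : (G.induce ({v}ᶜ : Set V)).edgeSet.ncard = n := by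
      have h1 := G.card_edgeFinset_induce_compl_singleton v
      rw [G.card_edgeFinset_deleteIncidenceSet, hvd, ← ncard_edge, he] at h1
      rw [ncard_edge]
      rw [Nat.add_sub_cancel] at h1
      convert h1
    have hm := three _ _ _ hHV hHc hHe
    have hsplit := leaf_split G v u huv hu k hk
    rw [hV] at hsplit
    obtain ⟨j, rfl⟩ := Nat.exists_eq_add_of_le' hk
    obtain ⟨m, rfl⟩ := Nat.exists_eq_add_of_le' hm
    have pas : (m + 3 + 1 - 1).choose (j + 3 - 1) = (m+2).choose (j+1) + (m+2).choose (j+2) :=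
      Nat.choose_succ_succ' (m+2) (j+1)
    have e1 : m + 3 + 1 - 2 = m + 2 := by omega
    have e2 : j + 3 - 2 = j + 1 := by omega
    have e3 : j + 3 - 1 = j + 2 := by omega
    rw [e1, e2] at hsplit
    by_cases hcyc : Nonempty (G.induce ({v}ᶜ : Set V) ≃g cycleGraph (m+3))
    · by_cases hkm : j + 3 < m + 3
      · obtain ⟨e⟩ := hcyc
        have a1 := (cyc_counts _ (m+3) hm e (j+3) hkm).1
        have a2 := (cyc_counts _ (m+3) hm e (j+3-1) (by omega)).2 ⟨u, huv.ne'⟩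
        have a3 := choose_bound (m+3) (j+2) (by omega) (by omega)
        have a4 : connCount G (j+3) ≤ m + 3 + (j + 3 - 1) := by
          refine hsplit.trans (Nat.add_le_add a1 ((min_le_right _ _).trans ?_))
          exact le_of_eq_of_le (by congr) a2
        rw [e3] at a4 ⊢
        rw [Nat.add_sub_cancel]
        omega
      · have a1 := connCount_triv (G.induce ({v}ᶜ : Set V)) (j+3)
        rw [hHV, Nat.choose_succ_succ' (m+2) (j+2), Nat.choose_eq_zero_of_lt (show m + 2 < j + 2 + 1 by omega)] at a1
        have a4 := hsplit.trans (Nat.add_le_add a1 (min_le_left _ _))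
        omega
    · have a1 := ih _ (G.induce ({v}ᶜ : Set V)) hHV hHc hHe hcyc (j+3) hk
      have a4 := hsplit.trans (Nat.add_le_add a1 (min_le_left _ _))
      rw [e3, show m + 3 - 1 = m + 2 by omega] at a4
      omega

open Classical in
lemma connCount_two {V : Type} [Fintype V] (G : SimpleGraph V) :
    connCount G 2 ≤ G.edgeSet.ncard := by
  rw [connCount_eq_s10, ncard_edge]
  calc _ ≤ (G.edgeFinset.image (fun e => Finset.univ.filter (fun x => x ∈ e))).card := by
        apply Finset.card_le_card
        intro S hS
        simp only [Finset.mem_filter, Finset.mem_univ, true_and] at hS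
        obtain ⟨hS2, hS⟩ := hS
        obtain ⟨a, b, hab, rfl⟩ := Finset.card_eq_two.1 hS2
        refine Finset.mem_image.2 ⟨s(a,b), ?_, by ext; simp⟩
        rw [mem_edgeFinset, mem_edgeSet]
        by_contra hnadj
        have := closed_univ hS.preconnected (fun x => x.1 = a) ⟨a, by simp⟩ rfl ?_ ⟨b, by simp⟩
        · exact hab this.symm
        · rintro ⟨x, hx⟩ ⟨y, hy⟩ hxa hxy
          have hxy' : G.Adj x y := hxy
          simp only at hxa
          subst hxa
          simp at hy
          rcases hy with rfl | rfl
          · rfl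
          · exact absurd hxy' hnadj
    _ ≤ _ := Finset.card_image_le

lemma U_conn (n : ℕ) (hn : 0 < n) (S : Finset (Fin n)) (h0 : (⟨0, hn⟩ : Fin n) ∈ S) :
    ((Ugraph n).induce (S : Set (Fin n))).Connected := by
  have : Nonempty (S : Set (Fin n)) := ⟨⟨_, h0⟩⟩
  have key : ∀ x : (S : Set (Fin n)), ((Ugraph n).induce (S : Set (Fin n))).Reachable ⟨_, h0⟩ x := by
    rintro ⟨x, hx⟩
    by_cases h : x = ⟨0, hn⟩
    · subst h; rfl
    · apply Adj.reachable
      simp [Ugraph, Ne.symm h]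
  exact ⟨fun x y => (key x).symm.trans (key y)⟩

open Classical in
lemma U_ge (n : ℕ) (hn : 0 < n) (k : ℕ) (hk : 1 ≤ k) :
    (n-1).choose (k-1) ≤ ((Finset.univ.filter (fun S : Finset (Fin n) => S.card = k ∧
      ((Ugraph n).induce (S : Set (Fin n))).Connected)).filter (fun S => (⟨0, hn⟩ : Fin n) ∈ S)).card := by
  have : (Finset.univ.erase (⟨0, hn⟩ : Fin n)).card = n - 1 := by simp
  rw [← this, ← Finset.card_powersetCard]
  apply Finset.card_le_card_of_injOn (fun S => insert ⟨0, hn⟩ S)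
  · intro S hS
    simp only [Finset.mem_coe, Finset.mem_powersetCard] at hS
    have h0 : (⟨0, hn⟩ : Fin n) ∉ S := fun h => by simpa using hS.1 h
    simp only [Finset.coe_filter, Finset.mem_filter, Finset.mem_univ, true_and, Set.mem_ofPred_eq]
    refine ⟨⟨?_, U_conn n hn _ (by simp)⟩, by simp⟩
    rw [Finset.card_insert_of_notMem h0, hS.2]; omega
  · intro S hS S' hS' h
    simp only [Finset.mem_coe, Finset.mem_powersetCard] at hS hS'
    have h0 : (⟨0, hn⟩ : Fin n) ∉ S := fun h => by simpa using hS.1 h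
    have h0' : (⟨0, hn⟩ : Fin n) ∉ S' := fun h => by simpa using hS'.1 h
    rw [← Finset.erase_insert h0, ← Finset.erase_insert h0']
    simp only at h
    rw [h]

open Classical in
lemma U_ge' (n : ℕ) (hn : 0 < n) (k : ℕ) (hk : 1 ≤ k) :
    (n-1).choose (k-1) ≤ connCount (Ugraph n) k := by
  refine (U_ge n hn k hk).trans ?_
  rw [connCount_eq_s10]
  apply Finset.card_le_card
  intro S hS
  simp only [Finset.mem_filter, Finset.mem_univ, true_and] at hS ⊢
  exact hS.1

open Classical in
lemma U_one (n : ℕ) : n ≤ connCount (Ugraph n) 1 := by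
  rw [connCount_eq_s10]
  conv_lhs => rw [← Fintype.card_fin n, ← Finset.card_univ]
  apply Finset.card_le_card_of_injOn (fun x => {x})
  · intro x _
    simp only [Finset.coe_filter, Finset.mem_univ, true_and, Set.mem_ofPred_eq, Finset.card_singleton,
      Finset.coe_singleton]
    have h1 : Nonempty ((({x} : Finset (Fin n)) : Set (Fin n))) := ⟨⟨x, by simp⟩⟩
    have h2 : Subsingleton ((({x} : Finset (Fin n)) : Set (Fin n))) :=
      ⟨fun a b => Subtype.ext (by
        have ha := a.2
        have hb := b.2
        simp only [Finset.coe_singleton, Set.mem_singleton_iff] at ha hb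
        rw [ha, hb])⟩
    exact ⟨Preconnected.of_subsingleton⟩
  · intro x _ y _ h
    simpa using h

open Classical in
lemma U_two (n : ℕ) (hn : 5 ≤ n) : n ≤ connCount (Ugraph n) 2 := by
  have h4 : connCount (Ugraph n) 2 = (Finset.univ.filter (fun S : Finset (Fin n) => S.card = 2 ∧
      ((Ugraph n).induce (S : Set (Fin n))).Connected)).card := by
    rw [connCount_eq_s10]
    congr
  rw [h4]
  have h3 := Finset.card_filter_add_card_filter_not
    (s := Finset.univ.filter (fun S : Finset (Fin n) => S.card = 2 ∧
      ((Ugraph n).induce (S : Set (Fin n))).Connected))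
    (p := fun S => (⟨0, by omega⟩ : Fin n) ∈ S)
  have h1 := U_ge n (by omega) 2 (by omega)
  simp only [Nat.add_one_sub_one, Nat.choose_one_right] at h1
  have h2 : 0 < ((Finset.univ.filter (fun S : Finset (Fin n) => S.card = 2 ∧
      ((Ugraph n).induce (S : Set (Fin n))).Connected)).filter
        (fun S => ¬ (⟨0, by omega⟩ : Fin n) ∈ S)).card := by
    rw [Finset.card_pos]
    refine ⟨{⟨1, by omega⟩, ⟨2, by omega⟩}, ?_⟩
    simp only [Finset.mem_filter, Finset.mem_univ, true_and]
    refine ⟨⟨by simp, ?_⟩, by simp⟩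
    have : (Ugraph n).Adj ⟨1, by omega⟩ ⟨2, by omega⟩ := by simp [Ugraph]
    rw [Finset.coe_pair]
    exact induce_pair_connected_of_adj this
  omega

/-- If `G` is a unicyclic graph (connected, with as many edges as vertices) of order
`n ≥ 5` not isomorphic to the cycle `C_n`, then `NRel(G,p) ≤ NRel(U_n,p)` for all
`p ∈ [0,1]`. -/
theorem nrel_le_Ugraph (n : ℕ) (hn : 5 ≤ n) (G : SimpleGraph (Fin n))
    (hconn : G.Connected) (hedges : G.edgeSet.ncard = n)
    (hniso : ¬ Nonempty (G ≃g SimpleGraph.cycleGraph n)) :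
    ∀ p : ℝ, 0 ≤ p → p ≤ 1 → NRel G p ≤ NRel (Ugraph n) p := by
  intro p hp0 hp1
  unfold NRel
  apply Finset.sum_le_sum
  intro k hk
  rw [Finset.mem_Icc] at hk
  have h1p : 0 ≤ 1 - p := by linarith
  have key : connCount G k ≤ connCount (Ugraph n) k := by
    rcases Nat.lt_or_ge k 3 with h | h
    · have : k = 1 ∨ k = 2 := by omega
      rcases this with rfl | rfl
      · refine le_trans ?_ (U_one n)
        simpa using connCount_triv G 1
      · exact (connCount_two G).trans (hedges.le.trans (U_two n hn))
    · refine (main_bound n (Fin n) G (by simp) hconn hedges hniso k h).trans ?_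
      exact U_ge' n (by omega) k hk.1
  have key' : (connCount G k : ℝ) ≤ connCount (Ugraph n) k := by exact_mod_cast key
  gcongr
end

section
/- Let G be a unicyclic graph of order n such that G is isomorphic to neither U_n nor C_n, and let v be a leaf (a vertex of degree 1) of G. Then the graph G − N[v] has at least two edges. -/
open SimpleGraph

open Classical in
theorem exists_perm3 (n : ℕ) (w a b z o t : Fin n) (h1 : w ≠ a) (h2 : w ≠ b) (h3 : a ≠ b)
    (k1 : z ≠ o) (k2 : z ≠ t) (k3 : o ≠ t) :
    ∃ σ : Fin n ≃ Fin n, σ w = z ∧ σ a = o ∧ σ b = t := by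
  obtain ⟨σ1, e1⟩ : ∃ σ : Fin n ≃ Fin n, σ w = z := ⟨Equiv.swap w z, by simp⟩
  obtain ⟨σ2, e2, e3⟩ : ∃ σ : Fin n ≃ Fin n, σ w = z ∧ σ a = o := by
    refine ⟨σ1.trans (Equiv.swap (σ1 a) o), ?_, by simp⟩
    have : σ1 a ≠ z := by rw [← e1]; exact fun h => h1 (σ1.injective h).symm
    simp [e1, Equiv.swap_apply_of_ne_of_ne this.symm k1]
  refine ⟨σ2.trans (Equiv.swap (σ2 b) t), ?_, ?_, by simp⟩
  · have : σ2 b ≠ z := by rw [← e2]; exact fun h => h2 (σ2.injective h).symm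
    simp [e2, Equiv.swap_apply_of_ne_of_ne this.symm k2]
  · have : σ2 b ≠ o := by rw [← e3]; exact fun h => h3 (σ2.injective h).symm
    simp [e3, Equiv.swap_apply_of_ne_of_ne this.symm k3]

/-- If `G` is a unicyclic graph of order `n` isomorphic to neither `U_n` nor `C_n`, and
`v` is a leaf of `G`, then `G − N[v]` has at least two edges. -/
theorem delClosedNbhd_two_edges (n : ℕ) (G : SimpleGraph (Fin n))
    (hconn : G.Connected) (hedges : G.edgeSet.ncard = n)
    (hnU : ¬ Nonempty (G ≃g Ugraph n))
    (hnC : ¬ Nonempty (G ≃g SimpleGraph.cycleGraph n))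
    (v : Fin n) (hv : (G.neighborSet v).ncard = 1) :
    2 ≤ (delClosedNbhd G v).edgeSet.ncard := by
  classical
  obtain ⟨w, hw⟩ := Set.ncard_eq_one.mp hv
  have hvw : ∀ x, G.Adj v x ↔ x = w := fun x => by
    have := Set.ext_iff.mp hw x
    simpa using this
  have hadj : G.Adj v w := (hvw w).2 rfl
  have himg : (Sym2.map Subtype.val) '' (delClosedNbhd G v).edgeSet
      = G.edgeSet \ G.incidenceSet w := by
    ext e
    induction e using Sym2.ind with
    | _ x y =>
    constructor
    · rintro ⟨e', he', h⟩
      induction e' using Sym2.ind with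
      | _ p q =>
      obtain ⟨p, hp⟩ := p
      obtain ⟨q, hq⟩ := q
      rw [Sym2.map_mk] at h
      rw [← h]
      have hpq : G.Adj p q := by simpa [delClosedNbhd] using he'
      simp only [Set.mem_setOf_eq, hvw] at hp hq
      refine ⟨hpq, fun hh => ?_⟩
      rcases Sym2.mem_iff.mp hh.2 with h | h
      · exact hp.1 h.symm
      · exact hq.1 h.symm
    · rintro ⟨h1, h2⟩
      have hxy : G.Adj x y := h1
      have hx : x ≠ w := fun h => h2 ⟨h1, by simp [h]⟩
      have hy : y ≠ w := fun h => h2 ⟨h1, by simp [h]⟩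
      have hx' : x ≠ v := by rintro rfl; exact hy ((hvw y).1 hxy)
      have hy' : y ≠ v := by rintro rfl; exact hx ((hvw x).1 hxy.symm)
      refine ⟨s(⟨x, by simp [hvw, hx, hx']⟩, ⟨y, by simp [hvw, hy, hy']⟩), ?_, by simp⟩
      simpa [delClosedNbhd] using hxy
  have hinj : (delClosedNbhd G v).edgeSet.ncard = (G.edgeSet \ G.incidenceSet w).ncard := by
    rw [← himg, Set.ncard_image_of_injective _ (Sym2.map.injective Subtype.val_injective)]
  have hinc : (G.incidenceSet w).ncard = G.degree w := by
    rw [← G.card_incidenceSet_eq_degree w, Set.ncard_eq_toFinset_card', Set.toFinset_card]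
  have hsum := Set.ncard_sdiff_add_ncard_of_subset (G.incidenceSet_subset w) (Set.toFinite _)
  have hdlt : G.degree w < n := by simpa using G.degree_lt_card_verts w
  rw [hinj]
  by_contra hlt
  have h1 : (G.edgeSet \ G.incidenceSet w).ncard = 1 := by omega
  have hdeg : G.degree w + 1 = n := by omega
  have huniv : ∀ x, x ≠ w → G.Adj w x := by
    have : insert w (G.neighborFinset w) = Finset.univ := by
      apply Finset.eq_univ_of_card
      rw [Finset.card_insert_of_notMem (by simp)]
      simpa using hdeg
    intro x hx
    have := this ▸ Finset.mem_univ x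
    simpa [hx] using this
  obtain ⟨e, he⟩ := Set.ncard_eq_one.mp h1
  induction e using Sym2.ind with
  | _ a b =>
  have hab : s(a, b) ∈ G.edgeSet \ G.incidenceSet w := he ▸ rfl
  have hA : G.Adj a b := hab.1
  have haw : w ≠ a := fun h => hab.2 ⟨hab.1, by simp [h]⟩
  have hbw : w ≠ b := fun h => hab.2 ⟨hab.1, by simp [h]⟩
  have hother : ∀ x y, G.Adj x y → x ≠ w → y ≠ w → s(x, y) = s(a, b) := by
    intro x y hxy hx hy
    have : s(x, y) ∈ G.edgeSet \ G.incidenceSet w := by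
      refine ⟨hxy, fun hh => ?_⟩
      rcases Sym2.mem_iff.mp hh.2 with h | h
      · exact hx h.symm
      · exact hy h.symm
    rw [he] at this
    exact this
  have hn : 3 ≤ n := by
    have := Finset.card_le_univ ({w, a, b} : Finset (Fin n))
    rw [Finset.card_eq_three.mpr ⟨w, a, b, haw, hbw, hA.ne, rfl⟩] at this
    simpa using this
  obtain ⟨σ, s0, s1, s2⟩ := exists_perm3 n w a b ⟨0, by omega⟩ ⟨1, by omega⟩ ⟨2, by omega⟩
    haw hbw hA.ne (by simp) (by simp) (by simp)
  have t0 : ∀ x, (σ x).val = 0 ↔ x = w := fun x => by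
    rw [← σ.injective.eq_iff, s0, Fin.ext_iff]
  have t1 : ∀ x, (σ x).val = 1 ↔ x = a := fun x => by
    rw [← σ.injective.eq_iff, s1, Fin.ext_iff]
  have t2 : ∀ x, (σ x).val = 2 ↔ x = b := fun x => by
    rw [← σ.injective.eq_iff, s2, Fin.ext_iff]
  refine hnU ⟨⟨σ, ?_⟩⟩
  intro x y
  simp only [Ugraph, SimpleGraph.fromRel_adj, t0, t1, t2, ne_eq, σ.injective.eq_iff]
  constructor
  · rintro ⟨hne, (rfl | ⟨rfl, rfl⟩) | (rfl | ⟨rfl, rfl⟩)⟩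
    · exact huniv y (Ne.symm hne)
    · exact hA
    · exact (huniv x hne).symm
    · exact hA.symm
  · intro hxy
    refine ⟨hxy.ne, ?_⟩
    by_cases hx : x = w
    · exact Or.inl (Or.inl hx)
    by_cases hy : y = w
    · exact Or.inr (Or.inl hy)
    rcases Sym2.eq_iff.mp (hother x y hxy hx hy) with h | h
    · exact Or.inl (Or.inr h)
    · exact Or.inr (Or.inr h.symm)
end

section
/- For every n ≥ 7 and all nonnegative integers n1, n2 with n1 + 2·n2 = n − 5, the graph F(n1,n2) satisfies S_k(F(n1,n2)) ≤ S_k(B_n) for every k ≥ 1. -/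
open SimpleGraph

/-- `F(n₁,n₂)`: the graph of order `n₁ + 2n₂ + 5` with centre `0`; vertices `1,2,3,4`
adjacent to the centre together with the extra edges `{1,2}` and `{3,4}`; `n₁` pendant
vertices `5,…,4+n₁` adjacent to the centre; and `n₂` vertices `5+n₁,…,4+n₁+n₂` adjacent
to the centre, the vertex `5+n₁+i` having exactly one further pendant neighbour
`5+n₁+n₂+i` (for `0 ≤ i < n₂`). -/
def Fgraph (n₁ n₂ : ℕ) : SimpleGraph (Fin (n₁ + 2 * n₂ + 5)) :=
  SimpleGraph.fromRel (fun a b =>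
    (b.val = 0 ∧ 1 ≤ a.val ∧ a.val ≤ 4 + n₁ + n₂) ∨
      (a.val = 1 ∧ b.val = 2) ∨ (a.val = 3 ∧ b.val = 4) ∨
      (5 + n₁ ≤ a.val ∧ a.val < 5 + n₁ + n₂ ∧ b.val = a.val + n₂))

lemma aux_const {V α : Type} (G : SimpleGraph V) (S : Finset V) (f : V → α)
    (hc : (G.induce (S : Set V)).Connected)
    (hf : ∀ x ∈ S, ∀ y ∈ S, G.Adj x y → f x = f y) :
    ∀ x ∈ S, ∀ y ∈ S, f x = f y := by
  intro x hx y hy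
  obtain ⟨w⟩ := hc.preconnected ⟨x, hx⟩ ⟨y, hy⟩
  have key : ∀ (u v : (S : Set V)) (_ : (G.induce (S : Set V)).Walk u v), f u = f v := by
    intro u v w
    induction w with
    | nil => rfl
    | cons h _ ih => exact (hf _ (Subtype.coe_prop _) _ (Subtype.coe_prop _) h).trans ih
  exact key _ _ w

lemma aux_B_zero (n : ℕ) (z : Fin n) (hz : z.val = 0) (S : Finset (Fin n)) (h : z ∈ S) :
    ((Bgraph n).induce (S : Set (Fin n))).Connected := by
  rw [connected_iff_exists_forall_reachable]
  refine ⟨⟨z, h⟩, ?_⟩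
  rintro ⟨y, hy⟩
  by_cases hzy : z = y
  · subst hzy; exact Reachable.refl _
  · apply Adj.reachable
    simp [Bgraph, SimpleGraph.fromRel_adj, hz, hzy]

lemma aux_B_pair (n : ℕ) (a b : Fin n) (h : (Bgraph n).Adj a b) :
    ((Bgraph n).induce (({a, b} : Finset (Fin n)) : Set (Fin n))).Connected := by
  have := induce_pair_connected_of_adj h
  rwa [Finset.coe_pair]

lemma aux_F_big (n₁ n₂ : ℕ) (S : Finset (Fin (n₁ + 2 * n₂ + 5))) (h : 2 < S.card)
    (hc : ((Fgraph n₁ n₂).induce (S : Set (Fin (n₁ + 2 * n₂ + 5)))).Connected) :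
    (0 : Fin (n₁ + 2 * n₂ + 5)) ∈ S := by
  by_contra h0
  have hne : ∀ x ∈ S, x.val ≠ 0 := by
    intro x hx hx0
    exact h0 ((Fin.ext hx0 : x = 0) ▸ hx)
  have := aux_const _ S (fun x : Fin (n₁ + 2 * n₂ + 5) =>
    if x.val = 2 then 1 else if x.val = 4 then 3 else
      if 5 + n₁ + n₂ ≤ x.val then x.val - n₂ else x.val) hc (by
    intro x hx y hy hxy
    have := hne x hx
    have := hne y hy
    simp only [Fgraph, SimpleGraph.fromRel_adj] at hxy
    have := x.isLt
    have := y.isLt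
    obtain ⟨_, hxy⟩ := hxy
    split_ifs <;> omega)
  obtain ⟨a, ha, b, hb, c, hc', hab, hac, hbc⟩ := Finset.two_lt_card.1 h
  have h1 := this a ha b hb
  have h2 := this a ha c hc'
  have := hne a ha
  have := hne b hb
  have := hne c hc'
  rw [Ne, Fin.ext_iff] at hab hac hbc
  have := a.isLt
  have := b.isLt
  have := c.isLt
  grind

lemma aux_pair {V : Type} [DecidableEq V] (G : SimpleGraph V) (S : Finset V) (h : S.card = 2)
    (hc : (G.induce (S : Set V)).Connected) : ∃ a b, S = {a, b} ∧ G.Adj a b := by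
  obtain ⟨a, b, hab, rfl⟩ := Finset.card_eq_two.1 h
  refine ⟨a, b, rfl, ?_⟩
  by_contra hn
  have hn' : ¬ G.Adj b a := fun h => hn h.symm
  have := aux_const G _ (fun x => x = a) hc (by
    intro x hx y hy hxy
    simp only [Finset.mem_insert, Finset.mem_singleton] at hx hy
    rcases hx with rfl | rfl <;> rcases hy with rfl | rfl <;> simp_all) a (by simp) b (by simp)
  simp at this
  exact hab this.symm

def auxE (n₁ n₂ : ℕ) : Option (Fin (n₁ + 2 * n₂ + 5)) → Finset (Fin (n₁ + 2 * n₂ + 5))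
  | none => {⟨3, by omega⟩, ⟨4, by omega⟩}
  | some b => if b.val = 0 then {⟨1, by omega⟩, ⟨2, by omega⟩} else
      if b.val ≤ 4 + n₁ + n₂ then {0, b} else {⟨b.val - n₂, by omega⟩, b}

lemma aux_F_two (n₁ n₂ : ℕ) (a b : Fin (n₁ + 2 * n₂ + 5)) (h : (Fgraph n₁ n₂).Adj a b) :
    ∃ o, auxE n₁ n₂ o = {a, b} := by
  simp only [Fgraph, SimpleGraph.fromRel_adj] at h
  obtain ⟨hne, h⟩ := h
  have key : ∀ a b : Fin (n₁ + 2 * n₂ + 5), ((b.val = 0 ∧ 1 ≤ a.val ∧ a.val ≤ 4 + n₁ + n₂) ∨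
      (a.val = 1 ∧ b.val = 2) ∨ (a.val = 3 ∧ b.val = 4) ∨
      (5 + n₁ ≤ a.val ∧ a.val < 5 + n₁ + n₂ ∧ b.val = a.val + n₂)) →
      ∃ o, auxE n₁ n₂ o = {a, b} := by
    rintro a b (⟨h0, h1, h2⟩ | ⟨h1, h2⟩ | ⟨h1, h2⟩ | ⟨h1, h2, h3⟩)
    · refine ⟨some a, ?_⟩
      have : b = 0 := Fin.ext h0
      subst this
      simp only [auxE]
      rw [if_neg (by omega), if_pos h2, Finset.pair_comm]
    · refine ⟨some 0, ?_⟩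
      simp only [auxE]
      rw [if_pos (by simp)]
      congr 1
      · exact Fin.ext h1.symm
      · congr 1; exact Fin.ext h2.symm
    · refine ⟨none, ?_⟩
      simp only [auxE]
      congr 1
      · exact Fin.ext h1.symm
      · congr 1; exact Fin.ext h2.symm
    · refine ⟨some b, ?_⟩
      simp only [auxE]
      rw [if_neg (by omega), if_neg (by omega)]
      congr 1
      apply Fin.ext; simp only; omega
  rcases h with h | h
  · exact key a b h
  · rw [Finset.pair_comm]; exact key b a h

def auxB (m : ℕ) : Option (Fin (m + 5)) → Finset (Fin (m + 5))
  | none => {⟨1, by omega⟩, ⟨m + 4, by omega⟩}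
  | some b => if b.val = 0 then {⟨1, by omega⟩, ⟨2, by omega⟩} else {0, b}

lemma auxB_spec (m : ℕ) (o) : (auxB m o).card = 2 ∧
    ((Bgraph (m + 5)).induce (auxB m o : Set (Fin (m + 5)))).Connected := by
  rcases o with _ | b
  · refine ⟨Finset.card_pair (by simp), aux_B_pair _ _ _ ?_⟩
    simp [Bgraph, SimpleGraph.fromRel_adj]
  · by_cases hb : b.val = 0
    · have e : auxB m (some b) = {⟨1, by omega⟩, ⟨2, by omega⟩} := if_pos hb
      rw [e]
      refine ⟨Finset.card_pair (by simp), aux_B_pair _ _ _ ?_⟩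
      simp [Bgraph, SimpleGraph.fromRel_adj]
    · have e : auxB m (some b) = {0, b} := if_neg hb
      rw [e]
      refine ⟨Finset.card_pair ?_, aux_B_zero _ 0 rfl _ (by simp)⟩
      intro h; exact hb (h ▸ rfl)

lemma auxB_inj (m : ℕ) : Function.Injective (auxB m) := by
  have hz : ((0 : Fin (m + 5)) : ℕ) = 0 := rfl
  have mem : ∀ o x, x ∈ auxB m o ↔ (o = none ∧ (x.val = 1 ∨ x.val = m + 4)) ∨
      ∃ b, o = some b ∧ ((b.val = 0 ∧ (x.val = 1 ∨ x.val = 2)) ∨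
        (b.val ≠ 0 ∧ (x.val = 0 ∨ x.val = b.val))) := by
    intro o x
    rcases o with _ | b
    · simp only [auxB, Finset.mem_insert, Finset.mem_singleton, Fin.ext_iff]; simp
    · simp only [auxB]
      split_ifs with hb <;>
        simp only [Finset.mem_insert, Finset.mem_singleton, Fin.ext_iff, hz] <;> simp only [reduceCtorEq, false_and, false_or, Option.some.injEq, exists_eq_left'] <;> omega
  intro o o' h
  have h' : ∀ x, x ∈ auxB m o ↔ x ∈ auxB m o' := fun x => by rw [h]
  simp only [mem] at h'
  have h0 := h' ⟨0, by omega⟩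
  have h2 := h' ⟨2, by omega⟩
  rcases o with _ | b <;> rcases o' with _ | c
  · rfl
  · simp at h0 h2; omega
  · simp at h0 h2; omega
  · have hb := h' b
    have hc := h' c
    simp at h0 h2 hb hc
    congr 1
    apply Fin.ext
    omega

/-- For every `n ≥ 7` and all nonnegative integers `n₁, n₂` with `n₁ + 2n₂ = n − 5`,
`S_k(F(n₁,n₂)) ≤ S_k(B_n)` for every `k ≥ 1`. -/
theorem connCount_Fgraph_le_Bgraph (n : ℕ) (hn : 7 ≤ n) (n₁ n₂ : ℕ)
    (h : n₁ + 2 * n₂ = n - 5) :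
    ∀ k, 1 ≤ k → connCount (Fgraph n₁ n₂) k ≤ connCount (Bgraph n) k := by
  intro k hk
  obtain rfl : n = n₁ + 2 * n₂ + 5 := by omega
  unfold connCount
  by_cases hk2 : k = 2
  · subst hk2
    refine le_trans (b := Nat.card (Option (Fin (n₁ + 2 * n₂ + 5)))) ?_ ?_
    · have : ∀ S : {S : Finset (Fin (n₁ + 2 * n₂ + 5)) // S.card = 2 ∧
          ((Fgraph n₁ n₂).induce (S : Set (Fin (n₁ + 2 * n₂ + 5)))).Connected},
          ∃ o, auxE n₁ n₂ o = S.1 := by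
        rintro ⟨S, hS, hc⟩
        obtain ⟨a, b, rfl, hab⟩ := aux_pair _ S hS hc
        exact aux_F_two _ _ a b hab
      choose f hf using this
      refine Nat.card_le_card_of_injective f ?_
      intro S T hST
      apply Subtype.ext
      rw [← hf S, ← hf T, hST]
    · refine Nat.card_le_card_of_injective
        (fun o => ⟨auxB (n₁ + 2 * n₂) o, auxB_spec _ o⟩) ?_
      intro o o' hoo
      exact auxB_inj _ (congrArg Subtype.val hoo)
  · refine Nat.card_le_card_of_injective (fun S => ⟨S.1, S.2.1, ?_⟩) ?_
    · obtain ⟨S, hS, hc⟩ := S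
      by_cases hk1 : k = 1
      · subst hk1
        obtain ⟨a, rfl⟩ := Finset.card_eq_one.1 hS
        rw [Finset.coe_singleton]
        have : Subsingleton ({a} : Set (Fin (n₁ + 2 * n₂ + 5))) := 
          Set.subsingleton_singleton.coe_sort
        exact (connected_iff _).2 ⟨Preconnected.of_subsingleton, ⟨⟨a, rfl⟩⟩⟩
      · exact aux_B_zero _ 0 rfl _ (aux_F_big _ _ S (by omega) hc)
    · intro S T hST
      exact Subtype.ext (Subtype.mk.inj hST)
end

section
/- Let G be a bicyclic graph of order n ≥ 5 with at least one leaf, such that G is not isomorphic to F(n1,n2) for any nonnegative integers n1, n2 with n1 + 2·n2 = n − 5. Then for every leaf v of G, the graph G − N[v] contains a connected set of order 3; consequently, S_k(P_3 ∪ K̄_{n−5}) ≤ S_k(G − N[v]) for every k ≥ 1, where P_3 ∪ K̄_{n−5} denotes the disjoint union of a path on 3 vertices with n−5 isolated vertices. -/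
open SimpleGraph

/-- `P_3 ∪ K̄_m`: the disjoint union of the path `0 − 1 − 2` with `m` isolated vertices,
on the vertex set `{0,…,m+2}`. -/
def pathUnionEmpty (m : ℕ) : SimpleGraph (Fin (m + 3)) :=
  SimpleGraph.fromRel (fun a b => (a.val = 0 ∧ b.val = 1) ∨ (a.val = 1 ∧ b.val = 2))


theorem aux_connCount_mono {V W : Type} [Finite W] (G : SimpleGraph V) (H : SimpleGraph W)
    (f : V ↪ W) (hf : ∀ a b, G.Adj a b → H.Adj (f a) (f b)) (k : ℕ) :
    connCount G k ≤ connCount H k := by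
  classical
  have : Finite (Finset W) := inferInstance
  unfold connCount
  refine Nat.card_le_card_of_injective
    (fun S => ⟨S.1.map f, by simpa using S.2.1, ?_⟩) ?_
  · have hc := S.2.2
    let g : G.induce (S.1 : Set V) →g H.induce ((S.1.map f : Finset W) : Set W) :=
      { toFun := fun x => ⟨f x.1, by simpa using x.2⟩
        map_rel' := by
          intro a b hab
          exact hf _ _ hab }
    refine hc.map g ?_
    rintro ⟨y, hy⟩
    simp only [Finset.coe_map, Set.mem_image, Finset.mem_coe] at hy
    obtain ⟨x, hx, rfl⟩ := hy
    exact ⟨⟨x, hx⟩, rfl⟩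
  · intro S T h
    apply Subtype.ext
    have := congrArg Subtype.val h
    exact Finset.map_injective f this

theorem aux_path_pos (m : ℕ) : 1 ≤ connCount (pathUnionEmpty m) 3 := by
  classical
  unfold connCount
  let a : Fin (m+3) := ⟨0, by omega⟩
  let b : Fin (m+3) := ⟨1, by omega⟩
  let c : Fin (m+3) := ⟨2, by omega⟩
  have hab : (pathUnionEmpty m).Adj a b := by
    simp [pathUnionEmpty, a, b]
  have hbc : (pathUnionEmpty m).Adj b c := by
    simp [pathUnionEmpty, c, b]
  have hcon : ((pathUnionEmpty m).induce (({a, b, c} : Finset (Fin (m+3))) : Set _)).Connected := by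
    rw [SimpleGraph.connected_iff_exists_forall_reachable]
    refine ⟨⟨b, by simp⟩, ?_⟩
    rintro ⟨w, hw⟩
    simp only [Finset.coe_insert, Finset.coe_singleton, Set.mem_insert_iff,
      Set.mem_singleton_iff] at hw
    rcases hw with rfl | rfl | rfl
    · exact SimpleGraph.Adj.reachable (by simpa using hab.symm)
    · exact SimpleGraph.Reachable.refl _
    · exact SimpleGraph.Adj.reachable (by simpa using hbc)
  have hcard : ({a, b, c} : Finset (Fin (m+3))).card = 3 := by
    rw [Finset.card_eq_three]
    exact ⟨a, b, c, by simp [a, b], by simp [a, c], by simp [b, c], rfl⟩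
  have : Nonempty {S : Finset (Fin (m+3)) // S.card = 3 ∧
    ((pathUnionEmpty m).induce (S : Set _)).Connected} := ⟨⟨_, hcard, hcon⟩⟩
  exact Nat.card_pos

theorem aux_embed {W : Type} [Fintype W] (m : ℕ) (H : SimpleGraph W)
    (hW : Fintype.card W = m + 3) (a b c : W) (hab : H.Adj b a) (hbc : H.Adj b c) (hac : a ≠ c)
    (k : ℕ) : connCount (pathUnionEmpty m) k ≤ connCount H k := by
  classical
  let f : Fin (m+3) → W := fun i => if i.val = 0 then a else if i.val = 1 then b else c
  let s : Finset (Fin (m+3)) := Finset.univ.filter (fun i => i.val < 3)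
  have hinj : Set.InjOn f s := by
    intro i hi j hj hij
    have h1 := hab.ne
    have h2 := hbc.ne
    simp only [s, Finset.coe_filter, Finset.mem_univ, true_and, Set.mem_setOf_eq] at hi hj
    apply Fin.ext
    simp only [f] at hij
    split_ifs at hij <;> first | omega | (exfalso; simp_all)
  obtain ⟨g, hg⟩ := Finset.exists_equiv_extend_of_card_eq (t := (Finset.univ : Finset W))
    (α := Fin (m+3)) (by simp [hW]) (s := s) (f := f) (by simp) hinj
  have hr : ∀ i j : Fin (m+3), ((i.val = 0 ∧ j.val = 1) ∨ (i.val = 1 ∧ j.val = 2)) →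
      H.Adj (g i).1 (g j).1 := by
    intro i j hij
    rw [hg i (by simp [s]; omega), hg j (by simp [s]; omega)]
    rcases hij with ⟨h1, h2⟩ | ⟨h1, h2⟩
    · simp only [f, h1, h2]; exact hab.symm
    · simp only [f, h1, h2]; exact hbc
  refine aux_connCount_mono _ _ (g.toEmbedding.trans (Function.Embedding.subtype _)) ?_ k
  intro i j hij
  simp only [pathUnionEmpty, SimpleGraph.fromRel_adj] at hij
  rcases hij.2 with h | h
  · exact hr i j h
  · exact (hr j i h).symm

theorem aux_iso (n n₁ n₂ : ℕ) (hn : n = n₁ + 2 * n₂ + 5) (G : SimpleGraph (Fin n)) (φ : ℕ → Fin n)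
    (h1 : ∀ y, G.Adj (φ 1) y ↔ y = φ 0 ∨ y = φ 2)
    (h2 : ∀ y, G.Adj (φ 2) y ↔ y = φ 0 ∨ y = φ 1)
    (h3 : ∀ y, G.Adj (φ 3) y ↔ y = φ 0 ∨ y = φ 4)
    (h4 : ∀ y, G.Adj (φ 4) y ↔ y = φ 0 ∨ y = φ 3)
    (hA : ∀ i, 5 ≤ i → i < 5 + n₁ → ∀ y, (G.Adj (φ i) y ↔ y = φ 0))
    (hB : ∀ i, 5 + n₁ ≤ i → i < 5 + n₁ + n₂ → ∀ y, (G.Adj (φ i) y ↔ y = φ 0 ∨ y = φ (i + n₂)))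
    (hC : ∀ i, 5 + n₁ + n₂ ≤ i → i < n₁ + 2 * n₂ + 5 → ∀ y, (G.Adj (φ i) y ↔ y = φ (i - n₂)))
    (hs : ∀ y, ∃ i < n₁ + 2 * n₂ + 5, φ i = y) :
    Nonempty (G ≃g Fgraph n₁ n₂) := by
  classical
  let ψ : Fin (n₁ + 2 * n₂ + 5) → Fin n := fun i => φ i.val
  have hsur : Function.Surjective ψ := by
    intro y
    obtain ⟨i, hi, h⟩ := hs y
    exact ⟨⟨i, hi⟩, h⟩
  have hbij : Function.Bijective ψ :=
    (Fintype.bijective_iff_surjective_and_card ψ).2 ⟨hsur, by simp [hn]⟩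
  have hinj : ∀ i j, i < n₁ + 2 * n₂ + 5 → j < n₁ + 2 * n₂ + 5 → (φ i = φ j ↔ i = j) := by
    intro i j hi hj
    constructor
    · intro h
      have := @hbij.1 ⟨i, hi⟩ ⟨j, hj⟩ h
      simpa using this
    · rintro rfl; rfl
  let R : ℕ → ℕ → Prop := fun a b => (b = 0 ∧ 1 ≤ a ∧ a ≤ 4 + n₁ + n₂) ∨
      (a = 1 ∧ b = 2) ∨ (a = 3 ∧ b = 4) ∨
      (5 + n₁ ≤ a ∧ a < 5 + n₁ + n₂ ∧ b = a + n₂)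
  have key : ∀ i j, i < n₁ + 2 * n₂ + 5 → j < n₁ + 2 * n₂ + 5 → i ≠ 0 →
      (G.Adj (φ i) (φ j) ↔ i ≠ j ∧ (R i j ∨ R j i)) := by
    intro i j hi hj h0
    have c : i = 1 ∨ i = 2 ∨ i = 3 ∨ i = 4 ∨ (5 ≤ i ∧ i < 5 + n₁) ∨
      (5 + n₁ ≤ i ∧ i < 5 + n₁ + n₂) ∨ (5 + n₁ + n₂ ≤ i) := by omega
    rcases c with rfl | rfl | rfl | rfl | ⟨c1, c2⟩ | ⟨c1, c2⟩ | c1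
    · rw [h1, hinj _ _ hj (by omega), hinj _ _ hj (by omega)]; simp only [R]; clear h1 h2 h3 h4 hA hB hC hs hinj; grind
    · rw [h2, hinj _ _ hj (by omega), hinj _ _ hj (by omega)]; simp only [R]; clear h1 h2 h3 h4 hA hB hC hs hinj; grind
    · rw [h3, hinj _ _ hj (by omega), hinj _ _ hj (by omega)]; simp only [R]; clear h1 h2 h3 h4 hA hB hC hs hinj; grind
    · rw [h4, hinj _ _ hj (by omega), hinj _ _ hj (by omega)]; simp only [R]; clear h1 h2 h3 h4 hA hB hC hs hinj; grind
    · rw [hA i c1 c2, hinj _ _ hj (by omega)]; simp only [R]; omega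
    · rw [hB i c1 c2, hinj _ _ hj (by omega), hinj _ _ hj (by omega)]; simp only [R]; clear h1 h2 h3 h4 hA hB hC hs hinj; grind
    · rw [hC i c1 hi, hinj _ _ hj (by omega)]; simp only [R]; omega
  refine ⟨(RelIso.symm ⟨Equiv.ofBijective ψ hbij, ?_⟩ : G ≃g Fgraph n₁ n₂)⟩
  intro i j
  show G.Adj (φ i.val) (φ j.val) ↔ (Fgraph n₁ n₂).Adj i j
  rw [Fgraph, SimpleGraph.fromRel_adj]
  change _ ↔ i ≠ j ∧ (R i.val j.val ∨ R j.val i.val)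
  rw [ne_eq, ← Fin.val_inj]
  by_cases hi : i.val = 0
  · by_cases hj : j.val = 0
    · rw [hi, hj]; simp
    · rw [G.adj_comm, key _ _ j.2 i.2 hj]
      constructor
      · rintro ⟨a, b⟩; exact ⟨fun h => a h.symm, b.symm⟩
      · rintro ⟨a, b⟩; exact ⟨fun h => a h.symm, b.symm⟩
  · exact key _ _ i.2 j.2 hi

theorem aux_enum {V : Type} [Inhabited V] (s : Finset V) :
    ∃ a : ℕ → V, (∀ i < s.card, a i ∈ s) ∧ ∀ x ∈ s, ∃ i < s.card, a i = x := by
  refine ⟨fun i => if h : i < s.card then (s.equivFin.symm ⟨i, h⟩).1 else default, ?_, ?_⟩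
  · intro i hi
    simp [hi]
  · intro x hx
    refine ⟨s.equivFin ⟨x, hx⟩, (s.equivFin ⟨x, hx⟩).2, ?_⟩
    simp

theorem aux_struct (n : ℕ) (G : SimpleGraph (Fin n)) (hconn : G.Connected)
    (hedges : G.edgeSet.ncard = n + 1) (u : Fin n)
    (hno : ∀ b a c, b ≠ u → a ≠ u → c ≠ u → G.Adj b a → G.Adj b c → a = c) :
    ∃ n₁ n₂ : ℕ, n₁ + 2 * n₂ + 5 = n ∧ Nonempty (G ≃g Fgraph n₁ n₂) := by
  classical
  have hcover : ∀ x, x ≠ u → G.Adj x u ∨ ∃ y, y ≠ u ∧ G.Adj x y ∧ G.Adj y u := by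
    intro x hx
    by_contra hcon
    push Not at hcon
    obtain ⟨hxu, hy⟩ := hcon
    have hr : Relation.ReflTransGen G.Adj x u :=
      (SimpleGraph.reachable_iff_reflTransGen x u).1 (hconn.preconnected x u)
    have : ∀ z, Relation.ReflTransGen G.Adj x z → z = x ∨ (z ≠ u ∧ G.Adj x z) := by
      intro z hz
      induction hz with
      | refl => left; rfl
      | @tail z w _ h2 ih =>
        rcases ih with rfl | ⟨hz1, hz2⟩
        · right
          refine ⟨?_, h2⟩
          rintro rfl
          exact hxu h2
        · left
          have hw : w ≠ u := by
            rintro rfl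
            exact hy z hz1 hz2 h2
          exact hno z w x hz1 hw hx h2 hz2.symm
    rcases this u hr with h | h
    · exact hx h.symm
    · exact h.1 rfl
  -- partner function
  have hp : ∃ p : Fin n → Fin n, ∀ x, x ≠ u → (∃ y, y ≠ u ∧ G.Adj x y) →
      p x ≠ u ∧ G.Adj x (p x) := by
    refine ⟨fun x => if h : ∃ y, y ≠ u ∧ G.Adj x y then h.choose else x, ?_⟩
    intro x _ h
    simp only [h, dif_pos]
    exact h.choose_spec
  obtain ⟨p, hp⟩ := hp
  let D : Finset (Fin n) := Finset.univ.filter (fun x => G.Adj x u)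
  let M : Finset (Fin n) := Finset.univ.filter (fun x => x ≠ u ∧ ∃ y, y ≠ u ∧ G.Adj x y)
  have hD : ∀ x, x ∈ D ↔ G.Adj x u := by intro x; simp [D]
  have hM : ∀ x, x ∈ M ↔ x ≠ u ∧ ∃ y, y ≠ u ∧ G.Adj x y := by intro x; simp [M]
  have hpu : ∀ x ∈ M, p x ≠ u := fun x hx => (hp x ((hM x).1 hx).1 ((hM x).1 hx).2).1
  have hpa : ∀ x ∈ M, G.Adj x (p x) := fun x hx => (hp x ((hM x).1 hx).1 ((hM x).1 hx).2).2
  have hMu : ∀ x ∈ M, x ≠ u := fun x hx => ((hM x).1 hx).1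
  have hDu : ∀ x ∈ D, x ≠ u := fun x hx => ((hD x).1 hx).ne
  have hpM : ∀ x ∈ M, p x ∈ M := fun x hx =>
    (hM _).2 ⟨hpu x hx, x, hMu x hx, (hpa x hx).symm⟩
  have huniq : ∀ x ∈ M, ∀ y, y ≠ u → G.Adj x y → y = p x := fun x hx y hy h =>
    hno x y (p x) (hMu x hx) hy (hpu x hx) h (hpa x hx)
  have hpp : ∀ x ∈ M, p (p x) = x := fun x hx =>
    (huniq (p x) (hpM x hx) x (hMu x hx) (hpa x hx).symm).symm
  -- adjacency
  have hadj : ∀ x, x ≠ u → ∀ y, G.Adj x y ↔ (y = u ∧ x ∈ D) ∨ (x ∈ M ∧ y = p x) := by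
    intro x hx y
    constructor
    · intro h
      by_cases hy : y = u
      · left; subst hy; exact ⟨rfl, (hD x).2 h⟩
      · right
        have : x ∈ M := (hM x).2 ⟨hx, y, hy, h⟩
        exact ⟨this, huniq x this y hy h⟩
    · rintro (⟨rfl, h⟩ | ⟨h, rfl⟩)
      · exact (hD x).1 h
      · exact hpa x h
  have hcov : ∀ x, x ≠ u → x ∈ D ∨ (x ∈ M ∧ p x ∈ D) := by
    intro x hx
    rcases hcover x hx with h | ⟨y, h1, h2, h3⟩
    · left; exact (hD x).2 h
    · right
      have : x ∈ M := (hM x).2 ⟨hx, y, h1, h2⟩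
      rw [huniq x this y h1 h2] at h3
      exact ⟨this, (hD _).2 h3⟩
  -- degrees
  have hdeg : ∀ x, x ≠ u → G.degree x = (if x ∈ D then 1 else 0) + (if x ∈ M then 1 else 0) := by
    intro x hx
    have hN : G.neighborFinset x = (if x ∈ D then {u} else ∅) ∪ (if x ∈ M then {p x} else ∅) := by
      ext y
      rw [SimpleGraph.mem_neighborFinset, hadj x hx, Finset.mem_union]
      by_cases h1 : x ∈ D <;> by_cases h2 : x ∈ M <;> simp [h1, h2]
    rw [← SimpleGraph.card_neighborFinset_eq_degree, hN, Finset.card_union_of_disjoint]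
    · by_cases h1 : x ∈ D <;> by_cases h2 : x ∈ M <;> simp [h1, h2]
    · by_cases h1 : x ∈ D <;> by_cases h2 : x ∈ M <;> simp [h1, h2]
      exact (hpu x h2).symm
  have hdegu : G.degree u = D.card := by
    rw [← SimpleGraph.card_neighborFinset_eq_degree]
    congr 1
    ext y
    rw [SimpleGraph.mem_neighborFinset, hD, G.adj_comm]
  have hsum : 2 * D.card + M.card = 2 * (n + 1) := by
    have h := G.sum_degrees_eq_twice_card_edges
    have he : G.edgeFinset.card = n + 1 := by
      rw [← hedges, Set.ncard_eq_toFinset_card', SimpleGraph.edgeFinset]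
    rw [he, ← Finset.add_sum_erase _ _ (Finset.mem_univ u), hdegu] at h
    have h' : ∑ x ∈ Finset.univ.erase u, G.degree x = D.card + M.card := by
      rw [Finset.sum_congr rfl (fun x hx => hdeg x (Finset.ne_of_mem_erase hx)),
        Finset.sum_add_distrib, Finset.sum_boole, Finset.sum_boole]
      simp only [Nat.cast_id]
      congr 2
      · ext x
        simp only [Finset.mem_filter, Finset.mem_erase, Finset.mem_univ, and_true]
        exact ⟨fun h => h.2, fun h => ⟨hDu x h, h⟩⟩
      · ext x
        simp only [Finset.mem_filter, Finset.mem_erase, Finset.mem_univ, and_true]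
        exact ⟨fun h => h.2, fun h => ⟨hMu x h, h⟩⟩
    omega
  let A : Finset (Fin n) := D \ M
  let C : Finset (Fin n) := M \ D
  let B : Finset (Fin n) := (D ∩ M).filter (fun x => p x ∉ D)
  let T : Finset (Fin n) := (D ∩ M).filter (fun x => p x ∈ D)
  have hBC : B.card = C.card := by
    refine Finset.card_bij' (fun x _ => p x) (fun x _ => p x) ?_ ?_ ?_ ?_
    · intro x hx
      simp only [B, C, Finset.mem_filter, Finset.mem_inter, Finset.mem_sdiff] at hx ⊢
      exact ⟨hpM x hx.1.2, hx.2⟩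
    · intro x hx
      simp only [B, C, Finset.mem_filter, Finset.mem_inter, Finset.mem_sdiff] at hx ⊢
      rw [hpp x hx.1]
      refine ⟨⟨?_, hpM x hx.1⟩, hx.2⟩
      rcases hcov x (hMu x hx.1) with h | h
      · exact absurd h hx.2
      · exact h.2
    · intro x hx
      simp only [B, Finset.mem_filter, Finset.mem_inter] at hx
      exact hpp x hx.1.2
    · intro x hx
      simp only [C, Finset.mem_sdiff] at hx
      exact hpp x hx.1
  have hDM : (D ∩ M).card = T.card + B.card :=
    (Finset.card_filter_add_card_filter_not (s := D ∩ M) (fun x => p x ∈ D)).symm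
  have hDc : A.card + (D ∩ M).card = D.card := Finset.card_sdiff_add_card_inter D M
  have hMc : C.card + (D ∩ M).card = M.card := by
    rw [Finset.inter_comm]; exact Finset.card_sdiff_add_card_inter M D
  have hU : (D ∪ M).card + 1 = n := by
    have : D ∪ M = Finset.univ.erase u := by
      ext x
      simp only [Finset.mem_union, Finset.mem_erase, Finset.mem_univ, and_true]
      constructor
      · rintro (h | h)
        · exact hDu x h
        · exact hMu x h
      · intro h
        rcases hcov x h with h | h
        · exact Or.inl h
        · exact Or.inr h.1
    rw [this, Finset.card_erase_of_mem (Finset.mem_univ u), Finset.card_univ, Fintype.card_fin]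
    have := u.2
    omega
  have hUI := Finset.card_union_add_card_inter D M
  have hT : T.card = 4 := by omega
  have hnn : A.card + 2 * B.card + 5 = n := by omega
  -- T structure
  have hTm : ∀ x, x ∈ T ↔ x ∈ D ∧ x ∈ M ∧ p x ∈ D := by
    intro x; simp [T, and_assoc]
  have hTp : ∀ x ∈ T, p x ∈ T := by
    intro x hx
    rw [hTm] at hx ⊢
    exact ⟨hx.2.2, hpM x hx.2.1, by rw [hpp x hx.2.1]; exact hx.1⟩
  obtain ⟨t1, ht1⟩ : T.Nonempty := Finset.card_pos.1 (by omega)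
  have ht2 := hTp t1 ht1
  obtain ⟨t3, ht3, ht3'⟩ : ∃ t ∈ T, t ∉ ({t1, p t1} : Finset (Fin n)) := by
    by_contra hcon
    push Not at hcon
    have h1 : T ⊆ {t1, p t1} := hcon
    have := Finset.card_le_card h1
    have := Finset.card_le_two (a := t1) (b := p t1)
    omega
  have ht4 := hTp t3 ht3
  simp only [Finset.mem_insert, Finset.mem_singleton, not_or] at ht3'
  have hTM : ∀ x ∈ T, x ∈ M := fun x hx => ((hTm x).1 hx).2.1
  have hn12 : t1 ≠ p t1 := (hpa t1 (hTM _ ht1)).ne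
  have hn34 : t3 ≠ p t3 := (hpa t3 (hTM _ ht3)).ne
  have hn14 : t1 ≠ p t3 := by
    intro h
    apply ht3'.2
    rw [h, hpp t3 (hTM _ ht3)]
  have hn24 : p t1 ≠ p t3 := by
    intro h
    apply ht3'.1
    rw [← hpp t3 (hTM _ ht3), ← h, hpp t1 (hTM _ ht1)]
  have hTall : ∀ x ∈ T, x = t1 ∨ x = p t1 ∨ x = t3 ∨ x = p t3 := by
    have hsub : ({t1, p t1, t3, p t3} : Finset (Fin n)) ⊆ T := by
      intro x hx
      simp only [Finset.mem_insert, Finset.mem_singleton] at hx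
      rcases hx with rfl | rfl | rfl | rfl <;> assumption
    have hc4 : ({t1, p t1, t3, p t3} : Finset (Fin n)).card = 4 := by
      rw [Finset.card_insert_of_notMem, Finset.card_insert_of_notMem, Finset.card_insert_of_notMem,
        Finset.card_singleton]
      · simpa using hn34
      · simp only [Finset.mem_insert, Finset.mem_singleton, not_or]
        exact ⟨fun h => ht3'.2 h.symm, hn24⟩
      · simp only [Finset.mem_insert, Finset.mem_singleton, not_or]
        exact ⟨hn12, fun h => ht3'.1 h.symm, hn14⟩
    have heq := Finset.eq_of_subset_of_card_le hsub (by omega)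
    intro x hx
    rw [← heq] at hx
    simpa using hx
  have : Inhabited (Fin n) := ⟨u⟩
  obtain ⟨a, ha1, ha2⟩ := aux_enum A
  obtain ⟨b, hb1, hb2⟩ := aux_enum B
  refine ⟨A.card, B.card, hnn, ?_⟩
  let φ : ℕ → Fin n := fun i => if i = 0 then u else if i = 1 then t1 else if i = 2 then p t1
    else if i = 3 then t3 else if i = 4 then p t3 else if i < 5 + A.card then a (i - 5)
    else if i < 5 + A.card + B.card then b (i - 5 - A.card) else p (b (i - 5 - A.card - B.card))
  have f0 : φ 0 = u := rfl
  have f1 : φ 1 = t1 := rfl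
  have f2 : φ 2 = p t1 := rfl
  have f3 : φ 3 = t3 := rfl
  have f4 : φ 4 = p t3 := rfl
  have fA : ∀ i < A.card, φ (5 + i) = a i := by
    intro i hi
    simp only [φ]
    rw [if_neg (by omega), if_neg (by omega), if_neg (by omega), if_neg (by omega),
      if_neg (by omega), if_pos (by omega)]
    congr 1; omega
  have fB : ∀ i < B.card, φ (5 + A.card + i) = b i := by
    intro i hi
    simp only [φ]
    rw [if_neg (by omega), if_neg (by omega), if_neg (by omega), if_neg (by omega),
      if_neg (by omega), if_neg (by omega), if_pos (by omega)]
    congr 1; omega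
  have fC : ∀ i < B.card, φ (5 + A.card + B.card + i) = p (b i) := by
    intro i hi
    simp only [φ]
    rw [if_neg (by omega), if_neg (by omega), if_neg (by omega), if_neg (by omega),
      if_neg (by omega), if_neg (by omega), if_neg (by omega)]
    congr 2; omega
  have hTadj : ∀ x ∈ T, ∀ y, G.Adj x y ↔ y = u ∨ y = p x := by
    intro x hx y
    have hx' := (hTm x).1 hx
    rw [hadj x (hMu x hx'.2.1)]
    simp [hx'.1, hx'.2.1]
  have hBm : ∀ x, x ∈ B ↔ x ∈ D ∧ x ∈ M ∧ p x ∉ D := by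
    intro x; simp [B, and_assoc]
  have hAm : ∀ x, x ∈ A ↔ x ∈ D ∧ x ∉ M := by
    intro x; simp [A]
  refine aux_iso n A.card B.card hnn.symm G φ ?_ ?_ ?_ ?_ ?_ ?_ ?_ ?_
  · rw [f1, f0, f2]; exact hTadj t1 ht1
  · rw [f1, f0, f2]
    have := hTadj _ ht2
    rwa [hpp t1 (hTM _ ht1)] at this
  · rw [f3, f0, f4]; exact hTadj t3 ht3
  · rw [f3, f0, f4]
    have := hTadj _ ht4
    rwa [hpp t3 (hTM _ ht3)] at this
  · intro i hi1 hi2 y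
    obtain ⟨j, rfl⟩ := Nat.exists_eq_add_of_le hi1
    have hj : j < A.card := by omega
    rw [fA j hj, f0]
    have hx := (hAm _).1 (ha1 j hj)
    rw [hadj _ (hDu _ hx.1)]
    simp [hx.1, hx.2]
  · intro i hi1 hi2 y
    obtain ⟨j, rfl⟩ := Nat.exists_eq_add_of_le hi1
    have hj : j < B.card := by omega
    rw [show 5 + A.card + j + B.card = 5 + A.card + B.card + j by omega, fB j hj, f0, fC j hj]
    have hx := (hBm _).1 (hb1 j hj)
    rw [hadj _ (hDu _ hx.1)]
    simp [hx.1, hx.2.1]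
  · intro i hi1 hi2 y
    obtain ⟨j, rfl⟩ := Nat.exists_eq_add_of_le hi1
    have hj : j < B.card := by omega
    rw [show 5 + A.card + B.card + j - B.card = 5 + A.card + j by omega, fB j hj, fC j hj]
    have hx := (hBm _).1 (hb1 j hj)
    rw [hadj _ (hpu _ hx.2.1), hpp _ hx.2.1]
    simp [hx.2.2, hpM _ hx.2.1]
  · intro y
    by_cases hyu : y = u
    · exact ⟨0, by omega, by rw [f0, hyu]⟩
    by_cases hyD : y ∈ D
    · by_cases hyM : y ∈ M
      · by_cases hpy : p y ∈ D
        · rcases hTall y ((hTm y).2 ⟨hyD, hyM, hpy⟩) with h | h | h | h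
          · exact ⟨1, by omega, by rw [f1, h]⟩
          · exact ⟨2, by omega, by rw [f2, h]⟩
          · exact ⟨3, by omega, by rw [f3, h]⟩
          · exact ⟨4, by omega, by rw [f4, h]⟩
        · obtain ⟨i, hi, h⟩ := hb2 y ((hBm y).2 ⟨hyD, hyM, hpy⟩)
          exact ⟨5 + A.card + i, by omega, by rw [fB i hi, h]⟩
      · obtain ⟨i, hi, h⟩ := ha2 y ((hAm y).2 ⟨hyD, hyM⟩)
        exact ⟨5 + i, by omega, by rw [fA i hi, h]⟩
    · rcases hcov y hyu with h | ⟨h1, h2⟩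
      · exact absurd h hyD
      · obtain ⟨i, hi, h⟩ := hb2 (p y) ((hBm _).2 ⟨h2, hpM y h1, by rwa [hpp y h1]⟩)
        exact ⟨5 + A.card + B.card + i, by omega, by rw [fC i hi, h, hpp y h1]⟩

/-- Let `G` be a bicyclic graph of order `n ≥ 5` with at least one leaf, such that `G` is
not isomorphic to `F(n₁,n₂)` for any nonnegative `n₁, n₂` with `n₁ + 2n₂ = n − 5`.  Then
for every leaf `v` of `G` the graph `G − N[v]` contains a connected set of order `3`;
consequently `S_k(P_3 ∪ K̄_{n−5}) ≤ S_k(G − N[v])` for every `k ≥ 1`. -/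
theorem bicyclic_delClosedNbhd (n : ℕ) (hn : 5 ≤ n) (G : SimpleGraph (Fin n))
    (hconn : G.Connected) (hedges : G.edgeSet.ncard = n + 1)
    (hleaf : ∃ w, (G.neighborSet w).ncard = 1)
    (hnF : ∀ n₁ n₂ : ℕ, n₁ + 2 * n₂ = n - 5 → ¬ Nonempty (G ≃g Fgraph n₁ n₂)) :
    ∀ v : Fin n, (G.neighborSet v).ncard = 1 →
      1 ≤ connCount (delClosedNbhd G v) 3 ∧
        ∀ k, 1 ≤ k → connCount (pathUnionEmpty (n - 5)) k ≤ connCount (delClosedNbhd G v) k := by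
  classical
  intro v hv
  obtain ⟨u, hu⟩ := Set.ncard_eq_one.1 hv
  have hvu : ∀ y, G.Adj v y ↔ y = u := by
    intro y
    have : y ∈ G.neighborSet v ↔ y ∈ ({u} : Set (Fin n)) := by rw [hu]
    simpa using this
  have huv : u ≠ v := ((hvu u).2 rfl).ne'
  suffices h : ∀ k, connCount (pathUnionEmpty (n - 5)) k ≤ connCount (delClosedNbhd G v) k from
    ⟨(aux_path_pos _).trans (h 3), fun k _ => h k⟩
  by_cases hno : ∀ b a c, b ≠ u → a ≠ u → c ≠ u → G.Adj b a → G.Adj b c → a = c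
  · obtain ⟨n₁, n₂, h1, h2⟩ := aux_struct n G hconn hedges u hno
    exact absurd h2 (hnF n₁ n₂ (by omega))
  · push Not at hno
    obtain ⟨b, a, c, hb, ha, hc, hba, hbc, hac⟩ := hno
    have hW : ∀ x y, x ≠ u → y ≠ u → G.Adj x y → (¬ G.Adj v x ∧ x ≠ v) := by
      intro x y hx hy hxy
      refine ⟨fun h => hx ((hvu x).1 h), ?_⟩
      rintro rfl
      exact hy ((hvu y).1 hxy)
    intro k
    refine aux_embed (n - 5) (delClosedNbhd G v) ?_ ⟨a, hW a b ha hb hba.symm⟩ ⟨b, hW b a hb ha hba⟩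
      ⟨c, hW c b hc hb hbc.symm⟩ hba hbc (fun h => hac (congrArg Subtype.val h)) k
    have : (Finset.univ.filter (fun x => ¬ G.Adj v x ∧ x ≠ v)) = (Finset.univ.erase u).erase v := by
      ext x
      simp only [Finset.mem_filter, Finset.mem_univ, true_and, Finset.mem_erase, hvu, and_true]
      tauto
    have h2 : Fintype.card ↥{x : Fin n | ¬ G.Adj v x ∧ x ≠ v} = 
        (Finset.univ.filter (fun x => ¬ G.Adj v x ∧ x ≠ v)).card := 
      Fintype.card_subtype _
    rw [h2, this, Finset.card_erase_of_mem (by simp [huv.symm]),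
      Finset.card_erase_of_mem (Finset.mem_univ u), Finset.card_univ, Fintype.card_fin]
    omega
end
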